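/- arXiv:2008.07692 — 3 statements merged into one kernel-verified Lean document; each statement's English description precedes it below -/
import Mathlib

section
/- Any planar polynomial differential system (ẋ, ẏ) = Σ_{j=1}^{m} a_j X_j(x,y) with m ≤ 3, where each X_j is a monomial vector field of the form (x^{n_j} y^{k_j}, 0) or (0, x^{n_j} y^{k_j}) with (n_j, k_j) ∈ ℕ₀² and a_j ∈ ℝ, has no limit cycle. -/
open Real Set

noncomputable section

/-- `φ` is a solution of the planar ODE `(ẋ,ẏ) = X(x,y)`. -/
def IsSolution (X : ℝ × ℝ → ℝ × ℝ) (φ : ℝ → ℝ × ℝ) : Prop :=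
  ∀ t : ℝ, HasDerivAt φ (X (φ t)) t

/-- `φ` is a (non-constant) periodic orbit of the system `(ẋ,ẏ) = X(x,y)`. -/
def IsPeriodicOrbit (X : ℝ × ℝ → ℝ × ℝ) (φ : ℝ → ℝ × ℝ) : Prop :=
  IsSolution X φ ∧ (∃ T > 0, Function.Periodic φ T) ∧ ¬ (∃ c, ∀ t, φ t = c)

/-- A limit cycle is a periodic orbit that is isolated in the set of all periodic
orbits: it has an open neighbourhood containing no other periodic orbit. -/
def IsLimitCycle (X : ℝ × ℝ → ℝ × ℝ) (φ : ℝ → ℝ × ℝ) : Prop :=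
  IsPeriodicOrbit X φ ∧
  ∃ U : Set (ℝ × ℝ), IsOpen U ∧ Set.range φ ⊆ U ∧
    ∀ ψ : ℝ → ℝ × ℝ, IsPeriodicOrbit X ψ → Set.range ψ ⊆ U →
      Set.range ψ = Set.range φ

/-- The system `(ẋ,ẏ) = X(x,y)` has at least `N` (pairwise distinct) limit cycles. -/
def HasAtLeastNLimitCycles (X : ℝ × ℝ → ℝ × ℝ) (N : ℕ) : Prop :=
  ∃ φ : Fin N → ℝ → ℝ × ℝ, (∀ i, IsLimitCycle X (φ i)) ∧
    ∀ i j, i ≠ j → Set.range (φ i) ≠ Set.range (φ j)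

/-- A monomial vector field: of the form `(x^n y^k, 0)` or `(0, x^n y^k)`. -/
def IsMonomialVF (Y : ℝ × ℝ → ℝ × ℝ) : Prop :=
  ∃ n k : ℕ, (Y = fun p : ℝ × ℝ => ((p.1 ^ n * p.2 ^ k : ℝ), (0:ℝ)))
    ∨ (Y = fun p : ℝ × ℝ => ((0:ℝ), (p.1 ^ n * p.2 ^ k : ℝ)))

section helpers

open Filter Topology NNReal Metric

/-- Global solutions exist for bounded, globally Lipschitz fields. -/
theorem exists_global_solution (G : ℝ × ℝ → ℝ × ℝ) (K : ℝ≥0) (hG : LipschitzWith K G)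
    (L : ℝ≥0) (hL : ∀ p, ‖G p‖ ≤ L) (p : ℝ × ℝ) :
    ∃ ψ : ℝ → ℝ × ℝ, ψ 0 = p ∧ IsSolution G ψ := by
  have key : ∀ n : ℕ, ∃ α : ℝ → ℝ × ℝ, α 0 = p ∧
      ∀ t ∈ Ioo (-(n:ℝ)-1) (n+1), HasDerivAt α (G (α t)) t := by
    intro n
    have h0 : (0:ℝ) ∈ Icc (-(n:ℝ)-1) (n+1) := by
      constructor <;> linarith [Nat.cast_nonneg (α := ℝ) n]
    have hP : IsPicardLindelof (fun _ => G) (⟨0, h0⟩ : Icc (-(n:ℝ)-1) (n+1)) p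
        (L * (n + 1)) 0 L K := by
      apply IsPicardLindelof.of_time_independent
      · intro x _; exact hL x
      · exact hG.lipschitzOnWith
      · push_cast
        simp only [sub_zero, zero_sub]
        rw [show -(-(n:ℝ) - 1) = n + 1 by ring, max_self]
    obtain ⟨α, h1, h2⟩ := hP.exists_eq_forall_mem_Icc_hasDerivWithinAt₀
    exact ⟨α, h1, fun t ht => (h2 t (Ioo_subset_Icc_self ht)).hasDerivAt
      (Icc_mem_nhds ht.1 ht.2)⟩
  choose α h0 hα using key
  have agree : ∀ n m : ℕ, n ≤ m → EqOn (α n) (α m) (Ioo (-(n:ℝ)-1) (n+1)) := by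
    intro n m hnm
    have hnm' : (n:ℝ) ≤ m := by exact_mod_cast hnm
    apply ODE_solution_unique_of_mem_Ioo (v := fun _ => G) (s := fun _ => univ) (K := K)
      (t₀ := 0)
    · intro t _; exact hG.lipschitzOnWith
    · constructor <;> linarith [Nat.cast_nonneg (α := ℝ) n]
    · intro t ht; exact ⟨hα n t ht, trivial⟩
    · intro t ht; exact ⟨hα m t ⟨by linarith [ht.1], by linarith [ht.2]⟩, trivial⟩
    · rw [h0, h0]
  have agree' : ∀ n m : ℕ, ∀ t : ℝ, |t| < n + 1 → |t| < m + 1 → α n t = α m t := by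
    intro n m t hn hm
    rw [abs_lt] at hn hm
    rcases le_total n m with h | h
    · exact agree n m h ⟨by linarith, by linarith⟩
    · exact (agree m n h ⟨by linarith, by linarith⟩).symm
  refine ⟨fun t => α ⌈|t|⌉₊ t, h0 _, fun t => ?_⟩
  have hd := hα (⌈|t|⌉₊) t (by
    have h1 := Nat.le_ceil |t|
    have := abs_le.1 h1
    constructor <;> linarith)
  refine hd.congr_of_eventuallyEq ?_
  have : ∀ᶠ s : ℝ in 𝓝 t, |s| < (⌈|t|⌉₊ : ℝ) + 1 := by
    apply (continuous_abs.tendsto t).eventually_lt_const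
    linarith [Nat.le_ceil |t|]
  filter_upwards [this] with s hs
  exact agree' _ _ s (by linarith [Nat.le_ceil |s|]) hs

theorem IsSolution.continuous {X : ℝ × ℝ → ℝ × ℝ} {φ : ℝ → ℝ × ℝ} (h : IsSolution X φ) :
    Continuous φ := continuous_iff_continuousAt.2 fun t => (h t).continuousAt

theorem IsSolution.fst {X : ℝ × ℝ → ℝ × ℝ} {φ : ℝ → ℝ × ℝ} (h : IsSolution X φ) (t : ℝ) :
    HasDerivAt (fun t => (φ t).1) (X (φ t)).1 t := (h t).fst

theorem IsSolution.snd {X : ℝ × ℝ → ℝ × ℝ} {φ : ℝ → ℝ × ℝ} (h : IsSolution X φ) (t : ℝ) :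
    HasDerivAt (fun t => (φ t).2) (X (φ t)).2 t := (h t).snd

/-- Periodic orbits are bounded. -/
theorem periodic_bdd {φ : ℝ → ℝ × ℝ} (hc : Continuous φ) {T : ℝ} (hT : 0 < T)
    (hp : Function.Periodic φ T) : ∃ M > 0, ∀ t, ‖φ t‖ ≤ M := by
  obtain ⟨M, hM⟩ := (isCompact_Icc (a := (0:ℝ)) (b := T)).exists_bound_of_continuousOn
    hc.continuousOn
  refine ⟨max M 1, by positivity, fun t => ?_⟩
  obtain ⟨s, hs, h⟩ := hp.exists_mem_Ico₀ hT t
  rw [h]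
  exact (hM s (Ico_subset_Icc_self hs)).trans (le_max_left _ _)

theorem lip_ball {X : ℝ × ℝ → ℝ × ℝ} (hX : ContDiff ℝ 1 X) (M : ℝ) :
    ∃ K : ℝ≥0, LipschitzOnWith K X (closedBall 0 M) :=
  hX.contDiffOn.exists_lipschitzOnWith one_ne_zero (convex_closedBall _ _)
    (isCompact_closedBall _ _)

/-- A periodic orbit contains no equilibria. -/
theorem IsPeriodicOrbit.ne_zero {X : ℝ × ℝ → ℝ × ℝ} (hX : ContDiff ℝ 1 X)
    {φ : ℝ → ℝ × ℝ} (h : IsPeriodicOrbit X φ) (t : ℝ) : X (φ t) ≠ 0 := by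
  intro h0
  obtain ⟨hs, ⟨T, hT, hp⟩, hn⟩ := h
  obtain ⟨M, hM0, hM⟩ := periodic_bdd hs.continuous hT hp
  obtain ⟨K, hK⟩ := lip_ball hX M
  apply hn
  refine ⟨φ t, fun s => ?_⟩
  have := ODE_solution_unique_univ (v := fun _ => X) (s := fun _ => closedBall 0 M) (K := K)
    (f := φ) (g := fun _ => φ t) (t₀ := t) (fun _ => hK)
    (fun r => ⟨hs r, by simpa using hM r⟩)
    (fun r => ⟨by simpa [h0] using hasDerivAt_const r (φ t), by simpa using hM t⟩) rfl
  exact congrFun this s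

/-- A periodic differentiable function has a critical point. -/
theorem periodic_crit {f f' : ℝ → ℝ} (hf : ∀ t, HasDerivAt f (f' t) t) {T : ℝ} (hT : 0 < T)
    (hp : Function.Periodic f T) : ∃ t, f' t = 0 := by
  have hc : Continuous f := continuous_iff_continuousAt.2 fun t => (hf t).continuousAt
  obtain ⟨c, _, h⟩ := exists_hasDerivAt_eq_zero hT hc.continuousOn
    (by simpa using (hp 0).symm) (fun x _ => hf x)
  exact ⟨c, h⟩

theorem IsPeriodicOrbit.exists_snd_ne {X : ℝ × ℝ → ℝ × ℝ} (hX : ContDiff ℝ 1 X)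
    {φ : ℝ → ℝ × ℝ} (h : IsPeriodicOrbit X φ) : ∃ t, (X (φ t)).2 ≠ 0 := by
  by_contra! hc
  obtain ⟨T, hT, hp⟩ := h.2.1
  obtain ⟨t, ht⟩ := periodic_crit (f := fun t => (φ t).1) h.1.fst hT
    (fun t => by simp only [hp t])
  exact h.ne_zero hX t (Prod.ext ht (hc t))

/-- A periodic function with nonnegative derivative has zero derivative. -/
theorem periodic_mono {f f' : ℝ → ℝ} (hf : ∀ t, HasDerivAt f (f' t) t) {T : ℝ} (hT : 0 < T)
    (hp : Function.Periodic f T) (h0 : ∀ t, 0 ≤ f' t) (t : ℝ) : f' t = 0 := by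
  have hm : Monotone f := monotone_of_deriv_nonneg (fun t => (hf t).differentiableAt)
    (fun t => by rw [(hf t).deriv]; exact h0 t)
  have hconst : ∀ s, f s = f 0 := by
    intro s
    obtain ⟨r, hr, h⟩ := hp.exists_mem_Ico₀ hT s
    rw [h]
    refine le_antisymm ?_ (hm hr.1)
    calc f r ≤ f T := hm hr.2.le
      _ = f 0 := by simpa using hp 0
  have hfc : f = fun _ => f 0 := funext hconst
  have := (hf t).unique (hfc ▸ hasDerivAt_const t (f 0) : HasDerivAt f 0 t)
  exact this

theorem periodic_anti {f f' : ℝ → ℝ} (hf : ∀ t, HasDerivAt f (f' t) t) {T : ℝ} (hT : 0 < T)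
    (hp : Function.Periodic f T) (h0 : ∀ t, f' t ≤ 0) (t : ℝ) : f' t = 0 := by
  have := periodic_mono (f := fun t => - f t) (f' := fun t => - f' t) (fun t => (hf t).neg) hT
    (fun t => by simp only [hp t]) (fun t => by linarith [h0 t]) t
  linarith

/-- Scalar linear equations: a solution that vanishes once vanishes identically. -/
theorem linear_zero {x g : ℝ → ℝ} (hg : Continuous g) (hx : ∀ t, HasDerivAt x (g t * x t) t)
    {t₀ : ℝ} (h0 : x t₀ = 0) (t : ℝ) : x t = 0 := by
  have hI : ∀ t, HasDerivAt (fun t => ∫ s in (0:ℝ)..t, g s) (g t) t := fun t =>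
    intervalIntegral.integral_hasDerivAt_right (hg.intervalIntegrable _ _)
      hg.aestronglyMeasurable.stronglyMeasurableAtFilter hg.continuousAt
  have hu : ∀ t, HasDerivAt (fun t => x t * exp (-∫ s in (0:ℝ)..t, g s)) 0 t := by
    intro t
    have := (hx t).mul (hI t).neg.exp
    refine this.congr_deriv ?_
    ring
  have := is_const_of_deriv_eq_zero (fun t => (hu t).differentiableAt)
    (fun t => (hu t).deriv) t t₀
  simp only [h0, zero_mul, mul_eq_zero] at this
  exact this.resolve_right (exp_ne_zero _)

/-- A periodic function cannot cross zero in one direction only. -/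
theorem crossing_pos {x x' : ℝ → ℝ} (hx : ∀ t, HasDerivAt x (x' t) t) {T : ℝ} (hT : 0 < T)
    (hp : Function.Periodic x T) {t₀ : ℝ} (h0 : x t₀ = 0) (hpos : ∀ t, x t = 0 → 0 < x' t) :
    False := by
  have h1 : ∀ t ∈ Icc t₀ (t₀ + T), 0 ≤ x t := by
    intro t ht
    exact image_le_of_deriv_right_lt_deriv_boundary (f := fun _ => 0) (f' := fun _ => 0)
      (B := x) (B' := x') continuousOn_const (fun _ _ => hasDerivWithinAt_const _ _ _)
      h0.ge hx (fun s _ hs => hpos s hs.symm) ht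
  have h2 : ∀ t, 0 ≤ x t := by
    intro t
    obtain ⟨s, hs, h⟩ := hp.exists_mem_Ico hT t t₀
    rw [h]; exact h1 s (Ico_subset_Icc_self hs)
  have hmin : IsLocalMin x t₀ := Filter.Eventually.of_forall fun t => by rw [h0]; exact h2 t
  exact (hpos t₀ h0).ne' (hmin.hasDerivAt_eq_zero (hx t₀))

theorem crossing {x x' : ℝ → ℝ} (hx : ∀ t, HasDerivAt x (x' t) t) {T : ℝ} (hT : 0 < T)
    (hp : Function.Periodic x T) {t₀ : ℝ} (h0 : x t₀ = 0) (a : ℝ)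
    (hpos : ∀ t, x t = 0 → 0 < a * x' t) :
    False :=
  crossing_pos (x := fun t => a * x t) (fun t => (hx t).const_mul a) hT
    (fun t => by simp only [hp t]) (t₀ := t₀) (by simp [h0])
    (fun t ht => by
      have ha : a ≠ 0 := by
        rintro rfl
        have := hpos t₀ h0
        simp at this
      exact hpos t ((mul_eq_zero.1 ht).resolve_left ha))

/-- Antiderivative of `y ^ k / y ^ l`. -/
theorem exists_antideriv (k l : ℕ) : ∃ G : ℝ → ℝ, ∀ y : ℝ, (l = 0 ∨ y ≠ 0) →
    HasDerivAt G (y ^ k / y ^ l) y := by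
  rcases Nat.eq_zero_or_pos l with rfl | hl
  · refine ⟨fun y => y ^ (k+1) / (k+1), fun y _ => ?_⟩
    have := (hasDerivAt_pow (k+1) y).div_const ((k:ℝ)+1)
    refine this.congr_deriv ?_
    have : (k:ℝ) + 1 ≠ 0 := by positivity
    push_cast
    simp
    field_simp
  · by_cases h : l = k + 1
    · refine ⟨Real.log, fun y hy => ?_⟩
      have hy : y ≠ 0 := by rcases hy with h | h; omega; exact h
      refine (Real.hasDerivAt_log hy).congr_deriv ?_
      subst h
      field_simp
      ring
    · have hne : ((k:ℝ) - l + 1) ≠ 0 := by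
        intro h'
        apply h
        have : (l:ℝ) = k + 1 := by linarith
        exact_mod_cast this
      refine ⟨fun y => y ^ ((k:ℤ) - l + 1) / ((k:ℝ) - l + 1), fun y hy => ?_⟩
      have hy : y ≠ 0 := by rcases hy with h | h; omega; exact h
      have := (hasDerivAt_zpow ((k:ℤ) - l + 1) y (Or.inl hy)).div_const ((k:ℝ) - l + 1)
      refine this.congr_deriv ?_
      push_cast
      rw [add_sub_cancel_right, zpow_sub₀ hy]
      simp only [zpow_natCast]
      field_simp

/-- Coordinatewise projection to the box of radius `N`. -/
def clampBox (N : ℝ) (p : ℝ × ℝ) : ℝ × ℝ := (max (-N) (min N p.1), max (-N) (min N p.2))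

theorem clampBox_lip (N : ℝ) : LipschitzWith 1 (clampBox N) := by
  have h1 : LipschitzWith 1 (fun p : ℝ × ℝ => max (-N) (min N p.1)) :=
    (LipschitzWith.prod_fst.const_min N).const_max (-N)
  have h2 : LipschitzWith 1 (fun p : ℝ × ℝ => max (-N) (min N p.2)) :=
    (LipschitzWith.prod_snd.const_min N).const_max (-N)
  have h3 := h1.prodMk h2
  rw [max_self] at h3
  exact h3

theorem clampBox_mem {N : ℝ} (hN : 0 < N) (p : ℝ × ℝ) : clampBox N p ∈ closedBall 0 N := by
  rw [mem_closedBall_zero_iff, Prod.norm_def]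
  have hN2 : -N ≤ N := by linarith
  exact max_le (abs_le.2 ⟨le_max_left _ _, max_le hN2 (min_le_left _ _)⟩)
    (abs_le.2 ⟨le_max_left _ _, max_le hN2 (min_le_left _ _)⟩)

theorem clampBox_of_mem {N : ℝ} {p : ℝ × ℝ} (hp : ‖p‖ ≤ N) : clampBox N p = p := by
  simp only [Prod.norm_def, Real.norm_eq_abs, sup_le_iff, abs_le] at hp
  obtain ⟨⟨a, b⟩, c, d⟩ := hp
  simp [clampBox, a, b, c, d]

theorem clampBox_refl {N : ℝ} (hN : 0 < N) (x y : ℝ) :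
    clampBox N (-x, y) = (-(clampBox N (x, y)).1, (clampBox N (x, y)).2) := by
  simp only [clampBox, Prod.mk.injEq, and_true]
  rcases le_total N x with h | h <;> rcases le_total x (-N) with hlow | hlow
  · linarith
  · rw [min_eq_right (by linarith : -x ≤ N), min_eq_left h, max_eq_left (by linarith : -x ≤ -N),
      max_eq_right (by linarith)]
  · rw [min_eq_left (by linarith : N ≤ -x), min_eq_right h, max_eq_right (by linarith : -N ≤ N),
      max_eq_left hlow, neg_neg]
  · rw [min_eq_right (by linarith : -x ≤ N), min_eq_right h, max_eq_right (by linarith : -N ≤ -x),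
      max_eq_right hlow]

/-- Time reversibility: a solution meeting the symmetry axis is symmetric. -/
theorem reflect_sol {G : ℝ × ℝ → ℝ × ℝ} {K : ℝ≥0} (hG : LipschitzWith K G)
    (hR : ∀ x y, G (-x, y) = ((G (x, y)).1, -(G (x, y)).2))
    {ψ : ℝ → ℝ × ℝ} (hψ : IsSolution G ψ) {τ : ℝ} (hτ : (ψ τ).1 = 0) (t : ℝ) :
    ψ t = (-(ψ (2 * τ - t)).1, (ψ (2 * τ - t)).2) := by
  have := ODE_solution_unique_univ (v := fun _ => G) (s := fun _ => univ) (K := K)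
    (f := ψ) (g := fun t => (-(ψ (2 * τ - t)).1, (ψ (2 * τ - t)).2)) (t₀ := τ)
    (fun _ => hG.lipschitzOnWith) (fun t => ⟨hψ t, trivial⟩)
    (fun t => ⟨?_, trivial⟩) ?_
  · exact congrFun this t
  · have h1 : HasDerivAt (fun t : ℝ => 2 * τ - t) (-1) t := by
      simpa using (hasDerivAt_id t).const_sub (2 * τ)
    have h2 := (hψ.fst (2 * τ - t)).comp t h1
    have h3 := (hψ.snd (2 * τ - t)).comp t h1
    refine (h2.neg.prodMk h3).congr_deriv ?_
    rw [hR]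
    simp
  · have : 2 * τ - τ = τ := by ring
    simp only [this]
    exact Prod.ext (by simp [hτ]) rfl

theorem sign_change {f : ℝ → ℝ} {d t δ : ℝ} (hδ : 0 < δ) (hf : HasDerivAt f d t) (h0 : f t = 0)
    (hd : d ≠ 0) : ∃ η, 0 < η ∧ η < δ ∧ f (t - η) * f (t + η) < 0 := by
  have h1 := hasDerivAt_iff_tendsto_slope.1 hf
  have h2 : Tendsto (fun s => d * slope f t s) (𝓝[≠] t) (𝓝 (d * d)) := h1.const_mul d
  have h3 : ∀ᶠ s in 𝓝[≠] t, 0 < d * slope f t s :=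
    h2.eventually_const_lt (mul_self_pos.2 hd)
  rw [eventually_nhdsWithin_iff, Metric.eventually_nhds_iff] at h3
  obtain ⟨ε, hε, h⟩ := h3
  have hm : 0 < min ε δ := lt_min hε hδ
  have e1 := min_le_left ε δ
  have e2 := min_le_right ε δ
  refine ⟨min ε δ / 2, by linarith, by linarith, ?_⟩
  set η := min ε δ / 2 with hη
  have hη0 : 0 < η := by linarith
  have a1 := h (y := t + η) (by rw [Real.dist_eq]; simp [abs_of_pos hη0]; linarith) (by simp [hη0.ne'])
  have a2 := h (y := t - η) (by rw [Real.dist_eq]; simp [abs_of_pos hη0]; linarith) (by simp [hη0.ne'])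
  rw [slope_def_field, h0] at a1 a2
  have b1 : 0 < d * f (t + η) := by
    have := mul_pos a1 hη0
    have e : d * ((f (t + η) - 0) / (t + η - t)) * η = d * f (t + η) := by
      rw [show t + η - t = η by ring]
      field_simp; ring
    rwa [e] at this
  have b2 : d * f (t - η) < 0 := by
    have := mul_pos a2 hη0
    have e : d * ((f (t - η) - 0) / (t - η - t)) * η = - (d * f (t - η)) := by
      rw [show t - η - t = - η by ring]
      field_simp; ring
    rw [e] at this
    linarith
  have := mul_neg_of_neg_of_pos b2 b1
  have hd2 : 0 < d * d := mul_self_pos.2 hd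
  by_contra! hc
  nlinarith [mul_nonneg hd2.le hc]

/-- Zeros with nonvanishing derivative are isolated. -/
theorem finite_zeros {x x' : ℝ → ℝ} (hx : ∀ t, HasDerivAt x (x' t) t)
    (hne : ∀ t, x t = 0 → x' t ≠ 0) (T : ℝ) : {t | t ∈ Icc 0 T ∧ x t = 0}.Finite := by
  by_contra hinf
  obtain ⟨z, _, hz⟩ := Set.Infinite.exists_accPt_of_subset_isCompact hinf
    (isCompact_Icc (a := (0:ℝ)) (b := T)) (fun t ht => ht.1)
  rw [accPt_iff_frequently_nhdsNE] at hz
  apply hz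
  by_cases h : x z = 0
  · filter_upwards [(hx z).eventually_ne (c := 0) (hne z h)] with s hs hmem
    exact hs hmem.2
  · have := (hx z).continuousAt.eventually_ne h
    filter_upwards [this.filter_mono nhdsWithin_le_nhds] with s hs hmem
    exact hs hmem.2

/-- A reversible system has no limit cycle meeting its axis of symmetry. -/
theorem rev_not_limit {X : ℝ × ℝ → ℝ × ℝ} (hX : ContDiff ℝ 1 X)
    (hR : ∀ x y, X (-x, y) = ((X (x, y)).1, -(X (x, y)).2))
    {φ : ℝ → ℝ × ℝ} (hφ : IsLimitCycle X φ) {t₀ : ℝ} (h0 : (φ t₀).1 = 0) : False := by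
  obtain ⟨hper, U, hU, hsub, huniq⟩ := hφ
  have hne := hper.ne_zero hX
  obtain ⟨hs, ⟨T, hT, hp⟩, -⟩ := hper
  -- shift time so that the axis is met at time zero
  obtain ⟨χ, hχ⟩ : ∃ χ : ℝ → ℝ × ℝ, χ = fun t => φ (t + t₀) := ⟨_, rfl⟩
  have hχs : IsSolution X χ := by
    intro t
    have := HasDerivAt.comp_add_const t t₀ (hs (t + t₀))
    simpa [hχ] using this
  have hχp : Function.Periodic χ T := by
    intro t
    simp only [hχ]
    rw [show t + T + t₀ = t + t₀ + T by ring, hp]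
  have hχr : Set.range χ = Set.range φ := by
    ext p
    constructor
    · rintro ⟨t, rfl⟩; exact ⟨t + t₀, by simp [hχ]⟩
    · rintro ⟨t, rfl⟩; exact ⟨t - t₀, by simp [hχ]⟩
  have hχ0 : (χ 0).1 = 0 := by simp [hχ, h0]
  have hχne : ∀ t, X (χ t) ≠ 0 := fun t => by simp only [hχ]; exact hne _
  have hχc := hχs.continuous
  rw [← hχr] at hsub huniq
  clear hχr hχ hne hp hs h0
  obtain ⟨M, hM0, hM⟩ := periodic_bdd hχc hT hχp
  obtain ⟨K, hK⟩ := lip_ball hX (M + 1)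
  have hN : 0 < M + 1 := by linarith
  obtain ⟨L, hL⟩ := (isCompact_closedBall (0 : ℝ × ℝ) (M + 1)).exists_bound_of_continuousOn
    hX.continuous.continuousOn
  obtain ⟨G, hGdef⟩ : ∃ G : ℝ × ℝ → ℝ × ℝ, G = fun p => X (clampBox (M + 1) p) := ⟨_, rfl⟩
  have hG : LipschitzWith K G := by
    rw [← lipschitzOnWith_univ]
    have := hK.comp ((clampBox_lip (M + 1)).lipschitzOnWith (s := univ))
      (fun p _ => clampBox_mem hN p)
    rw [mul_one] at this
    rw [hGdef]; exact this
  have hGL : ∀ p, ‖G p‖ ≤ (L.toNNReal : ℝ) := by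
    intro p
    rw [hGdef]
    exact (hL _ (clampBox_mem hN p)).trans (Real.le_coe_toNNReal L)
  have hGX : ∀ p, ‖p‖ ≤ M + 1 → G p = X p := by
    intro p hp; rw [hGdef]; simp only [clampBox_of_mem hp]
  have hGR : ∀ x y, G (-x, y) = ((G (x, y)).1, -(G (x, y)).2) := by
    intro x y
    rw [hGdef]; simp only [clampBox_refl hN]
    exact hR _ _
  have hχG : IsSolution G χ := by
    intro t
    rw [hGX _ (by linarith [hM t])]
    exact hχs t
  have haxis : ∀ t, (χ t).1 = 0 → (X (χ t)).1 ≠ 0 := by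
    intro t ht h
    apply hχne t
    have := congrArg Prod.snd (hR 0 (χ t).2)
    have e : χ t = (0, (χ t).2) := Prod.ext ht rfl
    rw [neg_zero, ← e] at this
    simp only at this
    exact Prod.ext h (by simp; linarith)
  have hhalf : (χ (T / 2)).1 = 0 := by
    have h1 := reflect_sol hG hGR hχG hχ0 (T / 2)
    have h2 := hχp (2 * 0 - T / 2)
    rw [show 2 * 0 - T / 2 + T = T / 2 by ring] at h2
    rw [← h2] at h1
    have := congrArg Prod.fst h1
    simp only at this
    linarith
  obtain ⟨η, hη0, hηT, hη⟩ := sign_change (δ := T / 2) (by linarith) (hχs.fst (T / 2)) hhalf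
    (haxis _ hhalf)
  have hcomp : IsCompact (Set.range χ) := by
    have : Set.range χ = χ '' Icc 0 T := by
      apply Subset.antisymm
      · rintro _ ⟨t, rfl⟩
        obtain ⟨s, hs, h⟩ := hχp.exists_mem_Ico₀ hT t
        exact ⟨s, Ico_subset_Icc_self hs, h.symm⟩
      · rintro _ ⟨t, _, rfl⟩; exact ⟨t, rfl⟩
    rw [this]
    exact isCompact_Icc.image hχc
  obtain ⟨ρ, hρ0, hρ⟩ := hcomp.exists_thickening_subset_open hU hsub
  have hne1 : (χ (T / 2 - η)).1 ≠ 0 := left_ne_zero_of_mul hη.ne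
  have hne2 : (χ (T / 2 + η)).1 ≠ 0 := right_ne_zero_of_mul hη.ne
  obtain ⟨ε, hε0, hερ, hε1, hεa, hεb⟩ : ∃ ε > 0, ε ≤ ρ ∧ ε ≤ 1 ∧
      ε ≤ |(χ (T / 2 - η)).1| ∧ ε ≤ |(χ (T / 2 + η)).1| := by
    refine ⟨min (min ρ 1) (min |(χ (T / 2 - η)).1| |(χ (T / 2 + η)).1|), ?_, ?_, ?_, ?_, ?_⟩
    · have := abs_pos.2 hne1
      have := abs_pos.2 hne2
      positivity
    · exact (min_le_left _ _).trans (min_le_left _ _)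
    · exact (min_le_left _ _).trans (min_le_right _ _)
    · exact (min_le_right _ _).trans (min_le_left _ _)
    · exact (min_le_right _ _).trans (min_le_right _ _)
  -- all nearby points of the axis lie on periodic orbits, hence on the range of `χ`
  have hmain : ∀ s ∈ Ioo 0 (ε * exp (-(K * (2 * T)))), ((0:ℝ), (χ 0).2 + s) ∈ Set.range χ := by
    intro s hs
    obtain ⟨ψ, hψ0, hψ⟩ := exists_global_solution G K hG _ hGL (0, (χ 0).2 + s)
    have hclose : ∀ t ∈ Icc 0 (2 * T), dist (ψ t) (χ t) < ε := by
      intro t ht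
      have h1 := dist_le_of_trajectories_ODE (v := fun _ => G) (K := K) (f := ψ) (g := χ)
        (a := 0) (b := 2 * T) (δ := s) (fun _ => hG) hψ.continuous.continuousOn
        (fun t _ => (hψ t).hasDerivWithinAt) hχc.continuousOn
        (fun t _ => (hχG t).hasDerivWithinAt) (by
          rw [hψ0, Prod.dist_eq, hχ0, Real.dist_eq, Real.dist_eq]
          simp [abs_of_pos hs.1, hs.1.le]) t ht
      have h2 : s * exp (K * (t - 0)) ≤ s * exp (K * (2 * T)) := by
        have := hs.1
        gcongr
        linarith [ht.2]
      have h3 : s * exp (K * (2 * T)) < ε := by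
        have := mul_lt_mul_of_pos_right hs.2 (exp_pos (K * (2 * T)))
        rwa [mul_assoc, ← exp_add, neg_add_cancel, exp_zero, mul_one] at this
      linarith
    have hfst : ∀ t ∈ Icc 0 (2 * T), |(ψ t).1 - (χ t).1| < ε := by
      intro t ht
      have := hclose t ht
      rw [Prod.dist_eq, Real.dist_eq] at this
      exact (le_max_left _ _).trans_lt this
    have ha := hfst (T / 2 - η) ⟨by linarith, by linarith⟩
    have hb := hfst (T / 2 + η) ⟨by linarith, by linarith⟩
    have hψc : Continuous fun t => (ψ t).1 := continuous_fst.comp hψ.continuous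
    obtain ⟨τ, hτ, hτ0⟩ : ∃ τ ∈ Icc (T / 2 - η) (T / 2 + η), (ψ τ).1 = 0 := by
      have hle : T / 2 - η ≤ T / 2 + η := by linarith
      rw [abs_lt] at ha hb
      rcases mul_neg_iff.1 hη with ⟨p1, p2⟩ | ⟨p1, p2⟩
      · rw [abs_of_pos p1] at hεa
        rw [abs_of_neg p2] at hεb
        exact intermediate_value_Icc' hle hψc.continuousOn
          ⟨by linarith [hb.1, hb.2], by linarith [ha.1, ha.2]⟩
      · rw [abs_of_neg p1] at hεa
        rw [abs_of_pos p2] at hεb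
        exact intermediate_value_Icc hle hψc.continuousOn
          ⟨by linarith [ha.1, ha.2], by linarith [hb.1, hb.2]⟩
    have hτpos : 0 < τ := by linarith [hτ.1]
    have hψp : Function.Periodic ψ (2 * τ) := by
      intro t
      rw [reflect_sol hG hGR hψ hτ0 (t + 2 * τ),
        reflect_sol hG hGR hψ (τ := 0) (by rw [hψ0]) t]
      rw [show 2 * τ - (t + 2 * τ) = 2 * 0 - t by ring]
    have hnear : ∀ t, ∃ r, dist (ψ t) (χ r) < ε := by
      intro t
      obtain ⟨r, hr, h⟩ := hψp.exists_mem_Ico₀ (by linarith) t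
      exact ⟨r, h ▸ hclose r ⟨hr.1, by linarith [hr.2, hτ.2]⟩⟩
    have hψX : IsSolution X ψ := by
      intro t
      rw [← hGX]
      · exact hψ t
      · obtain ⟨r, hr⟩ := hnear t
        have h1 := norm_le_norm_add_norm_sub' (ψ t) (χ r)
        rw [dist_eq_norm] at hr
        linarith [hM r]
    have hperψ : IsPeriodicOrbit X ψ := by
      refine ⟨hψX, ⟨2 * τ, by linarith, hψp⟩, ?_⟩
      rintro ⟨c, hc⟩
      have h1 : (ψ (T / 2 - η)).1 = 0 := by rw [hc, ← hc 0, hψ0]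
      rw [h1, zero_sub, abs_neg] at ha
      linarith
    have := huniq ψ hperψ (by
      rintro _ ⟨t, rfl⟩
      apply hρ
      obtain ⟨r, hr⟩ := hnear t
      exact mem_thickening_iff.2 ⟨χ r, ⟨r, rfl⟩, by linarith⟩)
    rw [← this]
    exact ⟨0, hψ0⟩
  have hfin := finite_zeros (x := fun t => (χ t).1) hχs.fst haxis T
  have hfin2 := hfin.image (fun t => (χ t).2 - (χ 0).2)
  have hpos : 0 < ε * exp (-(K * (2 * T))) := by positivity
  refine Set.Ioo_infinite hpos (hfin2.subset ?_)
  intro s hs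
  obtain ⟨t, ht⟩ := hmain s hs
  obtain ⟨r, hr, h⟩ := hχp.exists_mem_Ico₀ hT t
  rw [h] at ht
  exact ⟨r, ⟨Ico_subset_Icc_self hr, by rw [ht]⟩, by simp only [ht]; ring⟩

/-- Exchanging the two coordinates. -/
theorem swap_solution {X : ℝ × ℝ → ℝ × ℝ} {φ : ℝ → ℝ × ℝ} (h : IsSolution X φ) :
    IsSolution (fun p => (X p.swap).swap) (fun t => (φ t).swap) := by
  intro t
  exact (h.snd t).prodMk (h.fst t)

theorem swap_periodic {X : ℝ × ℝ → ℝ × ℝ} {φ : ℝ → ℝ × ℝ} (h : IsPeriodicOrbit X φ) :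
    IsPeriodicOrbit (fun p => (X p.swap).swap) (fun t => (φ t).swap) := by
  obtain ⟨hs, ⟨T, hT, hp⟩, hn⟩ := h
  refine ⟨swap_solution hs, ⟨T, hT, fun t => by simp only [hp t]⟩, ?_⟩
  rintro ⟨c, hc⟩
  exact hn ⟨c.swap, fun t => by rw [← hc t, Prod.swap_swap]⟩

theorem swap_limit {X : ℝ × ℝ → ℝ × ℝ} {φ : ℝ → ℝ × ℝ} (h : IsLimitCycle X φ) :
    IsLimitCycle (fun p => (X p.swap).swap) (fun t => (φ t).swap) := by
  obtain ⟨hper, U, hU, hsub, huniq⟩ := h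
  refine ⟨swap_periodic hper, Prod.swap ⁻¹' U, hU.preimage continuous_swap, ?_, ?_⟩
  · rintro _ ⟨t, rfl⟩
    simpa using hsub ⟨t, rfl⟩
  · intro ψ hψ hψU
    have h1 := swap_periodic hψ
    simp only [Prod.swap_swap] at h1
    have h2 := huniq _ h1 (by rintro _ ⟨t, rfl⟩; exact hψU ⟨t, rfl⟩)
    have e1 : Set.range ψ = Prod.swap '' Set.range (fun t => (ψ t).swap) := by
      rw [← Set.range_comp]; simp [Function.comp_def]
    have e2 : Set.range (fun t => (φ t).swap) = Prod.swap '' Set.range φ := by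
      rw [← Set.range_comp]; rfl
    rw [e1, e2, h2]

/-- The system with two monomials in the first and one in the second component. -/
def fieldM (a b c : ℝ) (n1 k1 n2 k2 n3 k3 : ℕ) : ℝ × ℝ → ℝ × ℝ := fun p =>
  (a * (p.1 ^ n1 * p.2 ^ k1) + b * (p.1 ^ n2 * p.2 ^ k2), c * (p.1 ^ n3 * p.2 ^ k3))

theorem fieldM_contDiff (a b c : ℝ) (n1 k1 n2 k2 n3 k3 : ℕ) :
    ContDiff ℝ 1 (fieldM a b c n1 k1 n2 k2 n3 k3) := by
  unfold fieldM
  fun_prop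

theorem nonvanish_sign {y : ℝ → ℝ} (hy : Continuous y) (h : ∀ t, y t ≠ 0) :
    (∀ t, 0 < y t) ∨ (∀ t, y t < 0) := by
  by_contra! hc
  obtain ⟨⟨s, hs⟩, t, ht⟩ := hc
  obtain ⟨r, hr⟩ := mem_range_of_exists_le_of_exists_ge hy ⟨s, hs⟩ ⟨t, ht⟩
  exact h r hr

theorem pow_sign {y : ℝ → ℝ} (hy : Continuous y) (k : ℕ) (h : k = 0 ∨ ∀ t, y t ≠ 0) :
    (∀ t, 0 < y t ^ k) ∨ (∀ t, y t ^ k < 0) := by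
  apply nonvanish_sign (hy.pow k)
  intro t
  rcases h with rfl | h
  · simp
  · exact pow_ne_zero _ (h t)

theorem fieldM_facts {a b c : ℝ} {n1 k1 n2 k2 n3 k3 : ℕ} {φ : ℝ → ℝ × ℝ}
    (h : IsPeriodicOrbit (fieldM a b c n1 k1 n2 k2 n3 k3) φ) :
    (k3 = 0 ∨ ∀ t, (φ t).2 ≠ 0) ∧ Odd n3 ∧ (∃ t, (φ t).1 = 0) := by
  have hC := fieldM_contDiff a b c n1 k1 n2 k2 n3 k3
  obtain ⟨u, hu⟩ := h.exists_snd_ne hC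
  obtain ⟨hs, ⟨T, hT, hp⟩, -⟩ := h
  have hc := hs.continuous
  have hx : Continuous fun t => (φ t).1 := continuous_fst.comp hc
  have hy : Continuous fun t => (φ t).2 := continuous_snd.comp hc
  have hper : Function.Periodic (fun t => (φ t).2) T := fun t => by simp only [hp t]
  have hcne : c ≠ 0 := by
    rintro rfl
    simp [fieldM] at hu
  have A : k3 = 0 ∨ ∀ t, (φ t).2 ≠ 0 := by
    rcases k3 with _ | k
    · exact Or.inl rfl
    · right
      intro t ht
      have := linear_zero (x := fun t => (φ t).2) (g := fun t => c * ((φ t).1 ^ n3 * (φ t).2 ^ k))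
        (by fun_prop) (fun t => (hs.snd t).congr_deriv (by simp only [fieldM]; ring)) ht u
      apply hu
      simp [fieldM, this]
  have hpos : ¬ ∀ t, 0 ≤ c * ((φ t).1 ^ n3 * (φ t).2 ^ k3) := fun h0 =>
    hu (periodic_mono (f := fun t => (φ t).2) hs.snd hT hper h0 u)
  have hneg : ¬ ∀ t, c * ((φ t).1 ^ n3 * (φ t).2 ^ k3) ≤ 0 := fun h0 =>
    hu (periodic_anti (f := fun t => (φ t).2) hs.snd hT hper h0 u)
  have hsign : ∃ σ : ℝ, σ ≠ 0 ∧ ∀ t, 0 < σ * (c * (φ t).2 ^ k3) := by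
    rcases pow_sign hy k3 A with h | h
    · exact ⟨c, hcne, fun t => by
        have := mul_pos (mul_self_pos.2 hcne) (h t)
        linarith⟩
    · exact ⟨-c, neg_ne_zero.2 hcne, fun t => by
        have := mul_neg_of_pos_of_neg (mul_self_pos.2 hcne) (h t)
        linarith⟩
  obtain ⟨σ, hσ, hσp⟩ := hsign
  have two : (∃ t, (φ t).1 ^ n3 < 0) ∧ (∃ t, 0 < (φ t).1 ^ n3) := by
    constructor
    · by_contra! h0
      have h1 : ∀ t, 0 ≤ σ * (c * ((φ t).1 ^ n3 * (φ t).2 ^ k3)) := fun t => by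
        have := mul_nonneg (hσp t).le (h0 t)
        linarith
      rcases lt_or_gt_of_ne hσ with h | h
      · exact hneg fun t => nonpos_of_mul_nonneg_right (h1 t) h
      · exact hpos fun t => nonneg_of_mul_nonneg_right (h1 t) h
    · by_contra! h0
      have h1 : ∀ t, σ * (c * ((φ t).1 ^ n3 * (φ t).2 ^ k3)) ≤ 0 := fun t => by
        have := mul_nonpos_of_nonneg_of_nonpos (hσp t).le (h0 t)
        linarith
      rcases lt_or_gt_of_ne hσ with h | h
      · exact hpos fun t => by
          by_contra! hh
          linarith [h1 t, mul_pos_of_neg_of_neg h hh]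
      · exact hneg fun t => by
          by_contra! hh
          linarith [h1 t, mul_pos h hh]
  have hodd : Odd n3 := by
    by_contra he
    rw [Nat.not_odd_iff_even] at he
    obtain ⟨t, ht⟩ := two.1
    exact absurd (he.pow_nonneg (φ t).1) (not_le.2 ht)
  refine ⟨A, hodd, ?_⟩
  obtain ⟨⟨s, hs⟩, t, ht⟩ := two
  have h1 : (φ s).1 < 0 := hodd.pow_neg_iff.1 hs
  have h2 : 0 < (φ t).1 := hodd.pow_pos_iff.1 ht
  exact mem_range_of_exists_le_of_exists_ge hx ⟨s, h1.le⟩ ⟨t, h2.le⟩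

theorem fieldM_core (a b c : ℝ) (k1 n2 k2 n3 k3 : ℕ) (φ : ℝ → ℝ × ℝ) :
    ¬ IsLimitCycle (fieldM a b c 0 k1 n2 k2 n3 k3) φ := by
  intro hlim
  have hC := fieldM_contDiff a b c 0 k1 n2 k2 n3 k3
  have hper := hlim.1
  obtain ⟨A, hodd, t₀, ht₀⟩ := fieldM_facts hper
  obtain ⟨u, hu⟩ := hper.exists_snd_ne hC
  have hne := hper.ne_zero hC
  obtain ⟨hs, ⟨T, hT, hp⟩, -⟩ := hper
  have hc := hs.continuous
  have hx : Continuous fun t => (φ t).1 := continuous_fst.comp hc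
  have hy : Continuous fun t => (φ t).2 := continuous_snd.comp hc
  have hpx : Function.Periodic (fun t => (φ t).1) T := fun t => by simp only [hp t]
  have hn3 : n3 ≠ 0 := by rintro rfl; simp at hodd
  have hcne : c ≠ 0 := by
    rintro rfl
    simp [fieldM] at hu
  by_cases hev : Even n2 ∨ b = 0
  · -- reversible with respect to the second axis
    refine rev_not_limit hC (fun x y => ?_) hlim ht₀
    simp only [fieldM, hodd.neg_pow, Prod.mk.injEq]
    refine ⟨?_, by ring⟩
    rcases hev with h | h
    · rw [h.neg_pow]; ring
    · rw [h]; ring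
  push Not at hev
  obtain ⟨hn2, hb⟩ := hev
  rw [Nat.not_even_iff_odd] at hn2
  by_cases hk2 : Even k2 ∨ ∀ t, (φ t).2 ≠ 0
  · -- strictly monotone energy
    obtain ⟨G, hG⟩ := exists_antideriv k1 k3
    have hV : ∀ t, HasDerivAt (fun t => c * ((φ t).1 ^ (n3 + 1) / (n3 + 1)) - a * G (φ t).2)
        (b * c * ((φ t).1 ^ (n2 + n3) * (φ t).2 ^ k2)) t := by
      intro t
      have h1 := (((hs.fst t).pow (n3 + 1)).div_const ((n3 : ℝ) + 1)).const_mul c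
      have h2 := ((hG (φ t).2 (A.imp id fun h => h t)).comp t (hs.snd t)).const_mul a
      refine (h1.sub h2).congr_deriv ?_
      have e1 : (n3 : ℝ) + 1 ≠ 0 := by positivity
      have e2 : (φ t).2 ^ k3 ≠ 0 := by
        rcases A with rfl | h
        · simp
        · exact pow_ne_zero _ (h t)
      simp only [fieldM]
      push_cast
      field_simp
      ring
    have hVp : Function.Periodic
        (fun t => c * ((φ t).1 ^ (n3 + 1) / (n3 + 1)) - a * G (φ t).2) T :=
      fun t => by simp only [hp t]
    have hxe : ∀ t, 0 ≤ (φ t).1 ^ (n2 + n3) := fun t => (hn2.add_odd hodd).pow_nonneg _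
    have hys : (∀ t, 0 ≤ (φ t).2 ^ k2) ∨ (∀ t, (φ t).2 ^ k2 ≤ 0) := by
      rcases hk2 with h | h
      · exact Or.inl fun t => h.pow_nonneg _
      · exact (pow_sign hy k2 (Or.inr h)).imp (fun h t => (h t).le) (fun h t => (h t).le)
    have hbc : b * c ≠ 0 := mul_ne_zero hb hcne
    have hVs : (∀ t, 0 ≤ b * c * ((φ t).1 ^ (n2 + n3) * (φ t).2 ^ k2)) ∨
        (∀ t, b * c * ((φ t).1 ^ (n2 + n3) * (φ t).2 ^ k2) ≤ 0) := by
      rcases hys with h | h <;> rcases lt_or_gt_of_ne hbc with h' | h'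
      · exact Or.inr fun t => mul_nonpos_of_nonpos_of_nonneg h'.le (mul_nonneg (hxe t) (h t))
      · exact Or.inl fun t => mul_nonneg h'.le (mul_nonneg (hxe t) (h t))
      · exact Or.inl fun t => mul_nonneg_of_nonpos_of_nonpos h'.le
          (mul_nonpos_of_nonneg_of_nonpos (hxe t) (h t))
      · exact Or.inr fun t => mul_nonpos_of_nonneg_of_nonpos h'.le
          (mul_nonpos_of_nonneg_of_nonpos (hxe t) (h t))
    have hV0 : ∀ t, b * c * ((φ t).1 ^ (n2 + n3) * (φ t).2 ^ k2) = 0 := by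
      rcases hVs with h | h
      · exact periodic_mono hV hT hVp h
      · exact periodic_anti hV hT hVp h
    have hxy : ∀ t, (φ t).1 = 0 ∨ (φ t).2 = 0 := fun t => by
      have := (mul_eq_zero.1 (hV0 t)).resolve_left hbc
      exact (mul_eq_zero.1 this).imp eq_zero_of_pow_eq_zero eq_zero_of_pow_eq_zero
    have hxu : (φ u).1 ≠ 0 := by
      intro h0
      apply hu
      simp [fieldM, h0, hn3]
    have hyu : (φ u).2 = 0 := (hxy u).resolve_left hxu
    have e1 := (hs.snd u).eventually_ne (c := 0) hu
    have e2 := (hx.continuousAt.eventually_ne hxu).filter_mono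
      (nhdsWithin_le_nhds (s := {u}ᶜ))
    obtain ⟨r, h1, h2⟩ := (e1.and e2).exists
    exact (hxy r).elim h2 h1
  push Not at hk2
  obtain ⟨hk2, v, hv⟩ := hk2
  rw [Nat.not_even_iff_odd] at hk2
  have hk3 : k3 = 0 := A.resolve_right fun h => h v hv
  subst hk3
  by_cases hk1 : Even k1
  · -- the second axis is crossed in one direction only
    refine crossing hs.fst hT hpx ht₀ a ?_
    intro t ht
    have hn2' : n2 ≠ 0 := by rintro rfl; simp at hn2
    have h1 : (fieldM a b c 0 k1 n2 k2 n3 0 (φ t)).1 = a * (φ t).2 ^ k1 := by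
      simp [fieldM, ht, hn2']
    have h2 : (fieldM a b c 0 k1 n2 k2 n3 0 (φ t)).2 = 0 := by
      simp [fieldM, ht, hn3]
    have h3 : a * (φ t).2 ^ k1 ≠ 0 := fun h => hne t (Prod.ext (h1.trans h) h2)
    rw [h1, ← mul_assoc]
    have h4 := left_ne_zero_of_mul h3
    have h5 := right_ne_zero_of_mul h3
    exact mul_pos (mul_self_pos.2 h4) (lt_of_le_of_ne (hk1.pow_nonneg _) h5.symm)
  · -- reversible with respect to the first axis
    rw [Nat.not_even_iff_odd] at hk1
    refine rev_not_limit (X := fun p => (fieldM a b c 0 k1 n2 k2 n3 0 p.swap).swap) ?_ ?_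
      (swap_limit hlim) (t₀ := v) hv
    · unfold fieldM
      simp only [Prod.swap_prod_mk, Prod.fst_swap, Prod.snd_swap]
      fun_prop
    · intro x y
      simp only [fieldM, Prod.swap_prod_mk, hk1.neg_pow, hk2.neg_pow, Prod.mk.injEq]
      refine ⟨by ring, by ring⟩

theorem fieldM_none (a b c : ℝ) (n1 k1 n2 k2 n3 k3 : ℕ) (φ : ℝ → ℝ × ℝ) :
    ¬ IsLimitCycle (fieldM a b c n1 k1 n2 k2 n3 k3) φ := by
  intro hlim
  rcases n1 with _ | n1
  · exact fieldM_core _ _ _ _ _ _ _ _ _ hlim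
  rcases n2 with _ | n2
  · refine fieldM_core b a c k2 (n1 + 1) k1 n3 k3 φ ?_
    have e : fieldM a b c (n1 + 1) k1 0 k2 n3 k3 = fieldM b a c 0 k2 (n1 + 1) k1 n3 k3 := by
      unfold fieldM
      funext p
      rw [add_comm]
    rwa [e] at hlim
  have hC := fieldM_contDiff a b c (n1 + 1) k1 (n2 + 1) k2 n3 k3
  obtain ⟨A, hodd, t₀, ht₀⟩ := fieldM_facts hlim.1
  obtain ⟨u, hu⟩ := hlim.1.exists_snd_ne hC
  have hs := hlim.1.1
  have hc := hs.continuous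
  have hn3 : n3 ≠ 0 := by rintro rfl; simp at hodd
  have := linear_zero (x := fun t => (φ t).1)
    (g := fun t => a * ((φ t).1 ^ n1 * (φ t).2 ^ k1) + b * ((φ t).1 ^ n2 * (φ t).2 ^ k2))
    (by fun_prop) (fun t => (hs.fst t).congr_deriv (by simp only [fieldM]; ring)) ht₀ u
  apply hu
  simp [fieldM, this, hn3]

/-- Fields with trivial second component. -/
theorem fst_none {P : ℝ × ℝ → ℝ} (hP : ContDiff ℝ 1 P) (φ : ℝ → ℝ × ℝ) :
    ¬ IsLimitCycle (fun p => (P p, 0)) φ := by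
  intro h
  obtain ⟨u, hu⟩ := h.1.exists_snd_ne (by fun_prop)
  exact hu rfl

theorem snd_none {P : ℝ × ℝ → ℝ} (hP : ContDiff ℝ 1 P) (φ : ℝ → ℝ × ℝ) :
    ¬ IsLimitCycle (fun p => (0, P p)) φ := by
  intro h
  exact fst_none (P := fun p => P p.swap) (by
    have : ContDiff ℝ 1 (Prod.swap : ℝ × ℝ → ℝ × ℝ) := contDiff_snd.prodMk contDiff_fst
    exact hP.comp this) _ (swap_limit h)

theorem fieldM_swap_none (a b c : ℝ) (n1 k1 n2 k2 n3 k3 : ℕ) (φ : ℝ → ℝ × ℝ) :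
    ¬ IsLimitCycle (fun p : ℝ × ℝ =>
      (c * (p.1 ^ n3 * p.2 ^ k3), a * (p.1 ^ n1 * p.2 ^ k1) + b * (p.1 ^ n2 * p.2 ^ k2))) φ := by
  intro h
  refine fieldM_none a b c k1 n1 k2 n2 k3 n3 (fun t => (φ t).swap) ?_
  have := swap_limit h
  convert this using 1
  funext p
  simp only [fieldM, Prod.swap_prod_mk, Prod.fst_swap, Prod.snd_swap]
  congr 1 <;> ring

/-- The case of exactly three terms. -/
theorem three_none (X : Fin 3 → ℝ × ℝ → ℝ × ℝ) (hX : ∀ j, IsMonomialVF (X j)) (a : Fin 3 → ℝ)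
    (φ : ℝ → ℝ × ℝ) : ¬ IsLimitCycle (fun p : ℝ × ℝ => ∑ j, a j • X j p) φ := by
  intro h
  obtain ⟨n0, k0, h0⟩ := hX 0
  obtain ⟨n1, k1, h1⟩ := hX 1
  obtain ⟨n2, k2, h2⟩ := hX 2
  have hsum : (fun p : ℝ × ℝ => ∑ j, a j • X j p) =
      fun p => a 0 • X 0 p + a 1 • X 1 p + a 2 • X 2 p := by
    funext p; rw [Fin.sum_univ_three]
  rw [hsum] at h
  rcases h0 with h0 | h0 <;> rcases h1 with h1 | h1 <;> rcases h2 with h2 | h2 <;>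
    rw [h0, h1, h2] at h <;>
    simp only [Prod.smul_mk, Prod.mk_add_mk, smul_eq_mul, mul_zero, add_zero, zero_add] at h
  · exact fst_none (by fun_prop) _ h
  · exact fieldM_none _ _ _ _ _ _ _ _ _ _ h
  · exact fieldM_none _ _ _ _ _ _ _ _ _ _ h
  · exact fieldM_swap_none _ _ _ _ _ _ _ _ _ _ h
  · exact fieldM_none _ _ _ _ _ _ _ _ _ _ h
  · exact fieldM_swap_none _ _ _ _ _ _ _ _ _ _ h
  · exact fieldM_swap_none _ _ _ _ _ _ _ _ _ _ h
  · exact snd_none (by fun_prop) _ h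

end helpers

/-- Any planar polynomial system `(ẋ,ẏ) = ∑_{j=1}^m a_j X_j(x,y)` with
`m ≤ 3`, where each `X_j` is a monomial vector field, has no limit cycle. -/
theorem statement2 (m : ℕ) (hm : m ≤ 3) (X : Fin m → ℝ × ℝ → ℝ × ℝ)
    (hX : ∀ j, IsMonomialVF (X j)) (a : Fin m → ℝ) :
    ∀ φ : ℝ → ℝ × ℝ, ¬ IsLimitCycle (fun p : ℝ × ℝ => ∑ j, a j • X j p) φ := by
  intro φ h
  -- pad with zero terms
  let Z : ℝ × ℝ → ℝ × ℝ := fun p => ((p.1 ^ 0 * p.2 ^ 0 : ℝ), (0:ℝ))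
  have hZ : IsMonomialVF Z := ⟨0, 0, Or.inl rfl⟩
  have hpad : ∀ p, ∑ j, a j • X j p = ∑ i : Fin 3,
      (if h : (i : ℕ) < m then a ⟨i, h⟩ else 0) •
        (if h : (i : ℕ) < m then X ⟨i, h⟩ else Z) p := by
    intro p
    interval_cases m <;> simp [Fin.sum_univ_succ]
  simp only [hpad] at h
  refine three_none _ (fun i => ?_) _ φ h
  by_cases hi : (i : ℕ) < m
  · simp only [hi, dif_pos]; exact hX _
  · simp only [hi, dif_neg, not_false_eq_true]; exact hZ
end
end

section
/- For every integer m ≥ 4 there exist real coefficients a_0, a_1, ..., a_{m-3} such that the classical Liénard system (ẋ, ẏ) = ( y, -x + a_0 y + a_1 y³ + ... + a_{m-3} y^{2m-5} ) has at least m - 3 limit cycles. In particular, the maximum number of limit cycles among planar polynomial systems whose right-hand side consists of m monomial vector fields is at least m - 3. -/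
open Real Set

noncomputable section

lemma hasDerivAt_comp_neg' {f : ℝ → ℝ} {f' t : ℝ} (h : HasDerivAt f f' (-t)) :
    HasDerivAt (fun t => f (-t)) (-f') t :=
  (HasDerivAt.comp t h (hasDerivAt_neg t)).congr_deriv (by simp)

lemma decay_zero (D D' : ℝ → ℝ) (c C : ℝ) (hc : 0 < c) (hD : ∀ t, HasDerivAt D (D' t) t)
    (h0 : ∀ t, 0 ≤ D t) (hC : ∀ t, D t ≤ C) (hd : ∀ t, D' t ≤ -c * D t) (t : ℝ) : D t = 0 := by
  have hE : ∀ t, HasDerivAt (fun t => D t * exp (c * t))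
      (D' t * exp (c * t) + D t * (exp (c * t) * c)) t := by
    intro t
    have h1 : HasDerivAt (fun t => exp (c * t)) (exp (c * t) * c) t := by
      have := ((hasDerivAt_id t).const_mul c).exp
      simpa using this
    exact (hD t).mul h1
  have hanti : Antitone (fun t => D t * exp (c * t)) := by
    apply antitone_of_deriv_nonpos (fun t => (hE t).differentiableAt)
    intro t
    rw [(hE t).deriv]
    have := hd t
    have h3 := exp_pos (c * t)
    nlinarith
  have hle : ∀ s, 0 ≤ s → D t ≤ C * exp (-(c * s)) := by
    intro s hs
    have h1 := hanti (show t - s ≤ t by linarith)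
    simp only at h1
    have h2 : exp (c * (t - s)) = exp (c * t) * exp (-(c * s)) := by
      rw [← exp_add]; congr 1; ring
    rw [h2] at h1
    have h3 := exp_pos (c * t)
    have h4 : D (t - s) * exp (-(c * s)) ≤ C * exp (-(c * s)) :=
      mul_le_mul_of_nonneg_right (hC _) (exp_pos _).le
    have h5 : D t * exp (c * t) ≤ (D (t - s) * exp (-(c * s))) * exp (c * t) := by linarith
    exact (le_of_mul_le_mul_right h5 h3).trans h4
  have hlim : Filter.Tendsto (fun s => C * exp (-(c * s))) Filter.atTop (nhds (C * 0)) := by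
    apply Filter.Tendsto.const_mul
    apply tendsto_exp_neg_atTop_nhds_zero.comp
    exact Filter.tendsto_id.const_mul_atTop hc
  have : D t ≤ C * 0 := by
    apply ge_of_tendsto hlim
    filter_upwards [Filter.eventually_ge_atTop 0] with s hs using hle s hs
  have := h0 t
  linarith

/-- two-sided version -/
lemma decay_zero' (d d' : ℝ → ℝ) (A c C : ℝ) (hA : A ≠ 0) (hc : 0 < c)
    (hD : ∀ t, HasDerivAt d (d' t) t)
    (hC : ∀ t, |d t| ≤ C) (hd : ∀ t, c * (d t) ^ 2 ≤ A * d t * d' t) (t : ℝ) : d t = 0 := by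
  have hsq : ∀ t, (d t)^2 ≤ C^2 := fun t => sq_le_sq' (abs_le.1 (hC t)).1 (abs_le.1 (hC t)).2
  rcases lt_or_gt_of_ne hA with h | h
  · have := decay_zero (fun t => (d t)^2) (fun t => 2 * d t * d' t) (2 * c / (-A)) (C^2)
      (by apply div_pos <;> linarith)
      (fun t => ((hD t).fun_pow 2).congr_deriv (by simp)) (fun t => sq_nonneg _) hsq (by
        intro t
        have := hd t
        have hA' : 0 < -A := by linarith
        rw [← neg_div, div_mul_eq_mul_div, le_div_iff₀ hA']
        nlinarith) t
    exact pow_eq_zero_iff (two_ne_zero) |>.1 this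
  · have := decay_zero (fun t => (d (-t))^2) (fun t => -(2 * d (-t) * d' (-t))) (2 * c / A) (C^2)
      (by apply div_pos <;> linarith)
      (fun t => by
        have h1 : HasDerivAt (fun t => d (-t)) (-(d' (-t))) t := by
          exact hasDerivAt_comp_neg' (hD (-t))
        have h2 := h1.fun_pow 2
        refine h2.congr_deriv ?_
        simp) (fun t => sq_nonneg _) (fun t => hsq _) (by
        intro t
        have := hd (-t)
        rw [← neg_div, div_mul_eq_mul_div, le_div_iff₀ h]
        nlinarith) (-t)
    have := pow_eq_zero_iff (two_ne_zero) |>.1 this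
    simpa using this

def expI (μ : ℝ) (G : ℝ → ℝ) (θ : ℝ) : ℝ := exp (-(μ * θ)) * ∫ s in Iic θ, exp (μ * s) * G s

lemma expI_int (μ : ℝ) (hμ : 0 < μ) (G : ℝ → ℝ) (hG : Continuous G) (C : ℝ)
    (hC : ∀ s, |G s| ≤ C) (θ : ℝ) :
    MeasureTheory.IntegrableOn (fun s => exp (μ * s) * G s) (Iic θ) := by
  have h1 := (integrableOn_exp_mul_Iic hμ θ).mul_const C
  refine MeasureTheory.Integrable.mono' h1 (by fun_prop) ?_
  filter_upwards with s
  rw [norm_mul, norm_eq_abs, norm_eq_abs, abs_exp]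
  exact mul_le_mul_of_nonneg_left (hC s) (exp_pos _).le

lemma expI_deriv (μ : ℝ) (hμ : 0 < μ) (G : ℝ → ℝ) (hG : Continuous G) (C : ℝ)
    (hC : ∀ s, |G s| ≤ C) (θ : ℝ) :
    HasDerivAt (expI μ G) (-μ * expI μ G θ + G θ) θ := by
  have hint := expI_int μ hμ G hG C hC
  have hc : Continuous (fun s => exp (μ * s) * G s) := by fun_prop
  have h1 : HasDerivAt (fun θ => ∫ s in Iic θ, exp (μ * s) * G s) (exp (μ * θ) * G θ) θ := by
    have h2 : (fun θ => ∫ s in Iic θ, exp (μ * s) * G s) =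
        fun θ => (∫ s in Iic (0:ℝ), exp (μ * s) * G s) + ∫ s in (0:ℝ)..θ, exp (μ * s) * G s := by
      funext x
      rw [← intervalIntegral.integral_Iic_sub_Iic (hint 0) (hint x)]
      ring
    rw [h2]
    apply HasDerivAt.const_add
    exact intervalIntegral.integral_hasDerivAt_right (hc.intervalIntegrable _ _)
      (hc.stronglyMeasurableAtFilter _ _) hc.continuousAt
  have h3 : HasDerivAt (fun θ => exp (-(μ * θ))) (exp (-(μ * θ)) * (-μ)) θ := by
    have := ((hasDerivAt_id θ).const_mul μ).neg.exp
    simpa using this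
  have h4 := h3.mul h1
  refine h4.congr_deriv ?_
  have h5 : exp (-(μ * θ)) * exp (μ * θ) = 1 := by rw [← exp_add]; simp
  unfold expI
  linear_combination (G θ) * h5

lemma expI_le (μ : ℝ) (hμ : 0 < μ) (G : ℝ → ℝ) (hG : Continuous G) (C : ℝ)
    (hC : ∀ s, |G s| ≤ C) (M : ℝ) (hM : ∀ s, G s ≤ μ * M) (θ : ℝ) : expI μ G θ ≤ M := by
  have h1 : ∫ s in Iic θ, exp (μ * s) * G s ≤ ∫ s in Iic θ, exp (μ * s) * (μ * M) := by
    apply MeasureTheory.integral_mono (expI_int μ hμ G hG C hC θ)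
      ((integrableOn_exp_mul_Iic hμ θ).mul_const _)
    intro s
    exact mul_le_mul_of_nonneg_left (hM s) (exp_pos _).le
  rw [MeasureTheory.integral_mul_const, integral_exp_mul_Iic hμ] at h1
  have h5 : exp (-(μ * θ)) * exp (μ * θ) = 1 := by rw [← exp_add]; simp
  calc expI μ G θ ≤ exp (-(μ * θ)) * (exp (μ * θ) / μ * (μ * M)) :=
        mul_le_mul_of_nonneg_left h1 (exp_pos _).le
    _ = M := by field_simp; rw [h5, one_mul]

lemma expI_neg (μ : ℝ) (G : ℝ → ℝ) (θ : ℝ) : expI μ (fun s => - G s) θ = - expI μ G θ := by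
  unfold expI
  simp only [mul_neg]
  rw [MeasureTheory.integral_neg]
  ring

lemma expI_ge (μ : ℝ) (hμ : 0 < μ) (G : ℝ → ℝ) (hG : Continuous G) (C : ℝ)
    (hC : ∀ s, |G s| ≤ C) (M : ℝ) (hM : ∀ s, μ * M ≤ G s) (θ : ℝ) : M ≤ expI μ G θ := by
  have := expI_le μ hμ (fun s => - G s) hG.neg C (by simpa using hC) (-M)
    (by intro s; have := hM s; linarith) θ
  rw [expI_neg] at this
  linarith

lemma expI_sub (μ : ℝ) (hμ : 0 < μ) (G G' : ℝ → ℝ) (hG : Continuous G) (hG' : Continuous G') (C : ℝ)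
    (hC : ∀ s, |G s| ≤ C) (hC' : ∀ s, |G' s| ≤ C) (θ : ℝ) :
    expI μ (fun s => G s - G' s) θ = expI μ G θ - expI μ G' θ := by
  unfold expI
  simp only [mul_sub]
  rw [MeasureTheory.integral_sub (expI_int μ hμ G hG C hC θ) (expI_int μ hμ G' hG' C hC' θ)]
  ring

lemma exists_bdd (F : ℝ → ℝ → ℝ) (hF : Continuous (Function.uncurry F)) (μ κ a b : ℝ) (hμ : 0 < μ)
    (hκ0 : 0 ≤ κ) (hκ : κ < μ) (hab : ∀ u θ, μ * a ≤ F u θ ∧ F u θ ≤ μ * b)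
    (hL : ∀ u v θ, |F u θ - F v θ| ≤ κ * |u - v|) :
    ∃ R : ℝ → ℝ, ∀ θ, (a ≤ R θ ∧ R θ ≤ b) ∧ HasDerivAt R (-μ * R θ + F (R θ) θ) θ := by
  set C := max |μ * a| |μ * b| with hCdef
  have hFC : ∀ u θ, |F u θ| ≤ C := fun u θ => abs_le_max_abs_abs (hab u θ).1 (hab u θ).2
  have hcont : ∀ R : BoundedContinuousFunction ℝ ℝ, Continuous (fun s => F (R s) s) := by
    intro R
    exact hF.comp (R.continuous.prodMk continuous_id)
  have hTc : ∀ R : BoundedContinuousFunction ℝ ℝ, Continuous (expI μ (fun s => F (R s) s)) := by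
    intro R
    exact continuous_iff_continuousAt.2 fun θ =>
      (expI_deriv μ hμ _ (hcont R) C (fun s => hFC _ _) θ).continuousAt
  have hTb : ∀ R : BoundedContinuousFunction ℝ ℝ, ∀ θ, a ≤ expI μ (fun s => F (R s) s) θ ∧
      expI μ (fun s => F (R s) s) θ ≤ b := fun R θ =>
    ⟨expI_ge μ hμ _ (hcont R) C (fun s => hFC _ _) a (fun s => (hab _ _).1) θ,
      expI_le μ hμ _ (hcont R) C (fun s => hFC _ _) b (fun s => (hab _ _).2) θ⟩
  let T : BoundedContinuousFunction ℝ ℝ → BoundedContinuousFunction ℝ ℝ := fun R =>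
    BoundedContinuousFunction.ofNormedAddCommGroup (expI μ (fun s => F (R s) s)) (hTc R)
      (max |a| |b|) (fun θ => abs_le_max_abs_abs (hTb R θ).1 (hTb R θ).2)
  have hT : ContractingWith (Real.toNNReal (κ / μ)) T := by
    constructor
    · rw [Real.toNNReal_lt_one]
      rwa [div_lt_one hμ]
    · apply LipschitzWith.of_dist_le_mul
      intro R S
      rw [Real.coe_toNNReal _ (by positivity)]
      rw [BoundedContinuousFunction.dist_le (by positivity)]
      intro θ
      show |expI μ (fun s => F (R s) s) θ - expI μ (fun s => F (S s) s) θ| ≤ _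
      rw [← expI_sub μ hμ _ _ (hcont R) (hcont S) C (fun s => hFC _ _) (fun s => hFC _ _)]
      have hb : ∀ s, |F (R s) s - F (S s) s| ≤ μ * (κ / μ * dist R S) := by
        intro s
        have h1 := hL (R s) (S s) s
        have h2 : |R s - S s| ≤ dist R S := by
          rw [← Real.dist_eq]; exact BoundedContinuousFunction.dist_coe_le_dist s
        have h3 : μ * (κ / μ * dist R S) = κ * dist R S := by field_simp
        rw [h3]
        exact h1.trans (mul_le_mul_of_nonneg_left h2 hκ0)
      rw [abs_le]
      constructor
      · exact expI_ge μ hμ (fun s => F (R s) s - F (S s) s) ((hcont R).sub (hcont S)) _ hb _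
          (fun s => by have := (abs_le.1 (hb s)).1; linarith) θ
      · exact expI_le μ hμ _ ((hcont R).sub (hcont S)) _ hb _ (fun s => (abs_le.1 (hb s)).2) θ
  have hfix := hT.fixedPoint_isFixedPt
  set R := ContractingWith.fixedPoint T hT
  have hR : (R : ℝ → ℝ) = expI μ (fun s => F (R s) s) := by
    have h1 : (T R : ℝ → ℝ) = R := by rw [hfix]
    exact h1.symm
  refine ⟨R, fun θ => ⟨?_, ?_⟩⟩
  · rw [hR]; exact hTb R θ
  · have := expI_deriv μ hμ _ (hcont R) C (fun s => hFC _ _) θ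
    rw [← hR] at this
    exact this

lemma exists_strip_neg (H : ℝ → ℝ → ℝ) (δ A : ℝ) (hδ : 0 < δ) (hA : A < 0)
    (hcont : ContinuousOn (Function.uncurry H) (Icc (-δ) δ ×ˢ univ))
    (hlip : ∀ θ, ∀ u ∈ Icc (-δ) δ, ∀ v ∈ Icc (-δ) δ,
      |H v θ - H u θ - A * (v - u)| ≤ |A| / 2 * |v - u|)
    (h0 : ∀ θ, |H 0 θ| ≤ |A| / 2 * δ) :
    ∃ R : ℝ → ℝ, ∀ θ, R θ ∈ Icc (-δ) δ ∧ HasDerivAt R (H (R θ) θ) θ := by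
  rw [abs_of_neg hA] at *
  set c : ℝ → ℝ := fun u => (projIcc (-δ) δ (by linarith) u : ℝ) with hc
  have hcm : ∀ u, c u ∈ Icc (-δ) δ := fun u => (projIcc (-δ) δ (by linarith) u).2
  have hcc : Continuous c := continuous_subtype_val.comp continuous_projIcc
  have hce : ∀ u ∈ Icc (-δ) δ, c u = u := fun u hu => by
    simp only [hc]; rw [projIcc_of_mem _ hu]
  have hcl : ∀ u v, |c u - c v| ≤ |u - v| := fun u v => abs_projIcc_sub_projIcc (by linarith)
  obtain ⟨R, hR⟩ := exists_bdd (fun u θ => -2 * A * c u + H (c u) θ) (by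
      have h1 : Continuous (fun z : ℝ × ℝ => H (c z.1) z.2) := by
        have := hcont.comp_continuous (f := fun z : ℝ × ℝ => (c z.1, z.2)) (by fun_prop)
          (fun z => ⟨hcm _, mem_univ _⟩)
        exact this
      exact ((continuous_const.mul (hcc.comp continuous_fst))).add h1)
    (-2 * A) (-3 / 2 * A) (-δ) δ (by linarith) (by linarith) (by linarith) (by
      intro u θ
      have hm := hcm u
      have h1 := h0 θ
      have e1 := hlip θ (c u) hm δ ⟨by linarith, le_refl _⟩
      have e2 := hlip θ (-δ) ⟨le_refl _, by linarith⟩ (c u) hm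
      have e3 := hlip θ 0 ⟨by linarith, by linarith⟩ δ ⟨by linarith, le_refl _⟩
      have e4 := hlip θ (-δ) ⟨le_refl _, by linarith⟩ 0 ⟨by linarith, by linarith⟩
      rw [abs_of_nonneg (a := δ - c u) (by linarith [hm.2]), abs_le] at e1
      rw [abs_of_nonneg (a := c u - -δ) (by linarith [hm.1]), abs_le] at e2
      rw [abs_of_nonneg (a := δ - 0) (by linarith), abs_le] at e3
      rw [abs_of_nonneg (a := 0 - -δ) (by linarith), abs_le] at e4
      rw [abs_le] at h1
      have f1 := mul_nonneg_of_nonpos_of_nonpos hA.le (show c u - δ ≤ 0 by linarith [hm.2])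
      have f2 := mul_nonneg_of_nonpos_of_nonpos hA.le (show -δ - c u ≤ 0 by linarith [hm.1])
      constructor <;> linarith [e1.1, e1.2, e2.1, e2.2, e3.1, e3.2, e4.1, e4.2, h1.1, h1.2]) (by
      intro u v θ
      have e := hlip θ (c v) (hcm v) (c u) (hcm u)
      have e' := hcl u v
      have e'' : |(-2 * A * c u + H (c u) θ) - (-2 * A * c v + H (c v) θ)| ≤
        |(-A) * (c u - c v)| + |H (c u) θ - H (c v) θ - A * (c u - c v)| := by
        refine le_trans (le_of_eq ?_) (abs_add_le _ _)
        congr 1; ring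
      rw [abs_mul, abs_of_pos (show 0 < -A by linarith)] at e''
      have := mul_le_mul_of_nonneg_left e' (show 0 ≤ -A by linarith)
      linarith)
  refine ⟨R, fun θ => ⟨(hR θ).1, (hR θ).2.congr_deriv ?_⟩⟩
  rw [hce _ (hR θ).1]
  ring

lemma exists_strip (H : ℝ → ℝ → ℝ) (δ A : ℝ) (hδ : 0 < δ) (hA : A ≠ 0)
    (hcont : ContinuousOn (Function.uncurry H) (Icc (-δ) δ ×ˢ univ))
    (hlip : ∀ θ, ∀ u ∈ Icc (-δ) δ, ∀ v ∈ Icc (-δ) δ,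
      |H v θ - H u θ - A * (v - u)| ≤ |A| / 2 * |v - u|)
    (h0 : ∀ θ, |H 0 θ| ≤ |A| / 2 * δ) :
    ∃ R : ℝ → ℝ, ∀ θ, R θ ∈ Icc (-δ) δ ∧ HasDerivAt R (H (R θ) θ) θ := by
  rcases lt_or_gt_of_ne hA with h | h
  · exact exists_strip_neg H δ A hδ h hcont hlip h0
  · obtain ⟨R, hR⟩ := exists_strip_neg (fun u θ => - H u (-θ)) δ (-A) hδ (by linarith)
      (by
        have : ContinuousOn (fun z : ℝ × ℝ => - Function.uncurry H (z.1, -z.2))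
            (Icc (-δ) δ ×ˢ univ) := by
          apply ContinuousOn.neg
          apply hcont.comp (by fun_prop)
          rintro z ⟨h1, h2⟩
          exact ⟨h1, mem_univ _⟩
        exact this)
      (by
        intro θ u hu v hv
        have := hlip (-θ) u hu v hv
        rw [abs_neg, ← abs_neg]
        refine le_trans (le_of_eq ?_) this
        congr 1; ring)
      (by intro θ; simpa using h0 (-θ))
    refine ⟨fun θ => R (-θ), fun θ => ⟨(hR _).1, ?_⟩⟩
    exact (hasDerivAt_comp_neg' (hR (-θ)).2).congr_deriv (by simp)

lemma polar_lift (x y dx dy : ℝ → ℝ) (hx : ∀ t, HasDerivAt x (dx t) t)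
    (hy : ∀ t, HasDerivAt y (dy t) t) (hdx : Continuous dx) (hdy : Continuous dy)
    (hpos : ∀ t, 0 < x t ^ 2 + y t ^ 2) :
    ∃ θ : ℝ → ℝ, ∀ t, HasDerivAt θ ((dx t * y t - x t * dy t) / (x t ^ 2 + y t ^ 2)) t ∧
      x t = √(x t ^ 2 + y t ^ 2) * sin (θ t) ∧ y t = √(x t ^ 2 + y t ^ 2) * cos (θ t) ∧
      HasDerivAt (fun t => √(x t ^ 2 + y t ^ 2))
        ((x t * dx t + y t * dy t) / √(x t ^ 2 + y t ^ 2)) t := by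
  have hxc : Continuous x := continuous_iff_continuousAt.2 fun t => (hx t).continuousAt
  have hyc : Continuous y := continuous_iff_continuousAt.2 fun t => (hy t).continuousAt
  set ω : ℝ → ℝ := fun t => (dx t * y t - x t * dy t) / (x t ^ 2 + y t ^ 2) with hω
  have hωc : Continuous ω := by
    apply Continuous.div (by fun_prop) (by fun_prop)
    intro t; exact (hpos t).ne'
  set r : ℝ → ℝ := fun t => √(x t ^ 2 + y t ^ 2) with hr
  have hrpos : ∀ t, 0 < r t := fun t => sqrt_pos.2 (hpos t)
  have hrsq : ∀ t, r t ^ 2 = x t ^ 2 + y t ^ 2 := fun t => sq_sqrt (hpos t).le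
  obtain ⟨θ0, h0x, h0y⟩ : ∃ θ0, x 0 = r 0 * sin θ0 ∧ y 0 = r 0 * cos θ0 := by
    refine ⟨Complex.arg ⟨y 0, x 0⟩, ?_, ?_⟩
    · have := Complex.norm_mul_sin_arg ⟨y 0, x 0⟩
      rw [Complex.norm_eq_sqrt_sq_add_sq] at this
      simp only at this
      rw [add_comm (y 0 ^ 2)] at this
      exact this.symm
    · have := Complex.norm_mul_cos_arg ⟨y 0, x 0⟩
      rw [Complex.norm_eq_sqrt_sq_add_sq] at this
      simp only at this
      rw [add_comm (y 0 ^ 2)] at this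
      exact this.symm
  have hrd : ∀ t, HasDerivAt r ((x t * dx t + y t * dy t) / r t) t := by
    intro t
    have h1 := (((hx t).fun_pow 2).add ((hy t).fun_pow 2)).sqrt (hpos t).ne'
    refine h1.congr_deriv ?_
    have := (hrpos t).ne'
    show _ / (2 * r t) = _
    simp
    field_simp
  have hn1 : ∀ t, HasDerivAt (fun t => x t / r t) (ω t * (y t / r t)) t := by
    intro t
    refine ((hx t).div (hrd t) (hrpos t).ne').congr_deriv ?_
    have h1 := (hrpos t).ne'
    have h2 := hrsq t
    simp only [hω]
    rw [← h2]
    field_simp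
    rw [h2]; ring
  have hn2 : ∀ t, HasDerivAt (fun t => y t / r t) (-(ω t * (x t / r t))) t := by
    intro t
    refine ((hy t).div (hrd t) (hrpos t).ne').congr_deriv ?_
    have h1 := (hrpos t).ne'
    have h2 := hrsq t
    simp only [hω]
    rw [← h2]
    field_simp
    rw [h2]; ring
  set θ : ℝ → ℝ := fun t => θ0 + ∫ s in (0:ℝ)..t, ω s with hθ
  have hθd : ∀ t, HasDerivAt θ (ω t) t := by
    intro t
    apply HasDerivAt.const_add
    exact intervalIntegral.integral_hasDerivAt_right (hωc.intervalIntegrable _ _)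
      (hωc.stronglyMeasurableAtFilter _ _) hωc.continuousAt
  have hθ0 : θ 0 = θ0 := by simp [hθ]
  have ha : ∀ t, x t / r t * cos (θ t) - y t / r t * sin (θ t) = 0 := by
    have hd : ∀ t, HasDerivAt (fun t => x t / r t * cos (θ t) - y t / r t * sin (θ t)) 0 t := by
      intro t
      refine (((hn1 t).mul (hθd t).cos).sub ((hn2 t).mul (hθd t).sin)).congr_deriv ?_
      ring
    intro t
    have h1 := is_const_of_deriv_eq_zero (fun t => (hd t).differentiableAt)
      (fun t => (hd t).deriv) t 0
    rw [h1, hθ0, h0x, h0y]; ring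
  have hb : ∀ t, x t / r t * sin (θ t) + y t / r t * cos (θ t) = 1 := by
    have hd : ∀ t, HasDerivAt (fun t => x t / r t * sin (θ t) + y t / r t * cos (θ t)) 0 t := by
      intro t
      refine (((hn1 t).mul (hθd t).sin).add ((hn2 t).mul (hθd t).cos)).congr_deriv ?_
      ring
    intro t
    have h1 := is_const_of_deriv_eq_zero (fun t => (hd t).differentiableAt)
      (fun t => (hd t).deriv) t 0
    rw [h1, hθ0, h0x, h0y]
    have := (hrpos 0).ne'
    field_simp
    exact sin_sq_add_cos_sq θ0
  refine ⟨θ, fun t => ⟨hθd t, ?_, ?_, hrd t⟩⟩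
  · have h1 := ha t
    have h2 := hb t
    have h3 := sin_sq_add_cos_sq (θ t)
    have : x t / r t = sin (θ t) := by
      linear_combination cos (θ t) * h1 + sin (θ t) * h2 - (x t / r t) * h3
    rw [div_eq_iff (hrpos t).ne'] at this
    rw [mul_comm]; exact this
  · have h1 := ha t
    have h2 := hb t
    have h3 := sin_sq_add_cos_sq (θ t)
    have : y t / r t = cos (θ t) := by
      linear_combination (-sin (θ t)) * h1 + cos (θ t) * h2 - (y t / r t) * h3
    rw [div_eq_iff (hrpos t).ne'] at this
    rw [mul_comm]; exact this

lemma surj_of_deriv (τ w : ℝ → ℝ) (hτd : ∀ θ, HasDerivAt τ (w θ) θ) (hlow : ∀ θ, 1 / 2 ≤ w θ) :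
    Function.Surjective τ := by
  have hm2 : Monotone (fun θ => τ θ - 1 / 2 * θ) := by
    have hd : ∀ θ, HasDerivAt (fun θ => τ θ - 1 / 2 * θ) (w θ - 1 / 2 * 1) θ := fun θ =>
      (hτd θ).sub ((hasDerivAt_id θ).const_mul _)
    apply monotone_of_deriv_nonneg (fun θ => (hd θ).differentiableAt)
    intro θ; rw [(hd θ).deriv]; linarith [hlow θ]
  have hτc : Continuous τ := continuous_iff_continuousAt.2 fun t => (hτd t).continuousAt
  apply hτc.surjective
  · apply Filter.tendsto_atTop_mono' _ _
      (Filter.tendsto_atTop_add_const_right _ (τ 0)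
        (Filter.tendsto_id.const_mul_atTop (show (0:ℝ) < 1 / 2 by norm_num)))
    filter_upwards [Filter.eventually_ge_atTop 0] with θ hθ
    have := hm2 hθ
    simp only [sub_zero, mul_zero] at this
    simp only [id]; linarith
  · apply Filter.tendsto_atBot_mono' _ _
      (Filter.tendsto_atBot_add_const_right _ (τ 0)
        (Filter.tendsto_id.const_mul_atBot (show (0:ℝ) < 1 / 2 by norm_num)))
    filter_upwards [Filter.eventually_le_atBot 0] with θ hθ
    have := hm2 hθ
    simp only [sub_zero, mul_zero] at this
    simp only [id]; linarith

lemma inv_time (w : ℝ → ℝ) (hw : Continuous w) (hlow : ∀ θ, 1 / 2 ≤ w θ)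
    (hper : Function.Periodic w (2 * π)) :
    ∃ T > 0, ∃ ϑ : ℝ → ℝ, Function.Surjective ϑ ∧ (∀ t, HasDerivAt ϑ (w (ϑ t))⁻¹ t) ∧
      ∀ t, ϑ (t + T) = ϑ t + 2 * π := by
  set τ : ℝ → ℝ := fun θ => ∫ s in (0:ℝ)..θ, w s with hτ
  have hτd : ∀ θ, HasDerivAt τ (w θ) θ := fun θ =>
    intervalIntegral.integral_hasDerivAt_right (hw.intervalIntegrable _ _)
      (hw.stronglyMeasurableAtFilter _ _) hw.continuousAt
  have hwpos : ∀ θ, 0 < w θ := fun θ => by linarith [hlow θ]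
  have hmono : StrictMono τ := by
    apply strictMono_of_deriv_pos
    intro θ; rw [(hτd θ).deriv]; exact hwpos θ
  have hτ0 : τ 0 = 0 := by simp [hτ]
  have hsurj : Function.Surjective τ := surj_of_deriv τ w hτd hlow
  let e := hmono.orderIsoOfSurjective τ hsurj
  have he : ∀ t, τ (e.symm t) = t := fun t => e.apply_symm_apply t
  refine ⟨τ (2 * π), ?_, e.symm, e.symm.surjective, ?_, ?_⟩
  · rw [← hτ0]; exact hmono (by positivity)
  · intro t
    exact HasDerivAt.of_local_left_inverse e.symm.continuous.continuousAt (hτd _)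
      (hwpos _).ne' (Filter.Eventually.of_forall he)
  · intro t
    apply hmono.injective
    have h1 : τ (e.symm t + 2 * π) = τ (e.symm t) + τ (2 * π) := by
      have := hper.intervalIntegral_add_eq_add 0 (e.symm t) (fun t₁ t₂ => hw.intervalIntegrable _ _)
      simp only [zero_add] at this
      exact this
    rw [he, h1, he]

def lien (ε : ℝ) (g : ℝ → ℝ) : ℝ × ℝ → ℝ × ℝ := fun p => (p.2, -p.1 + ε * g p.2)

lemma construct (ε : ℝ) (g r : ℝ → ℝ) (hg : Continuous g) (hr : ∀ θ, 0 < r θ)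
    (hper : Function.Periodic r (2 * π))
    (hΩ : ∀ θ, |ε * sin θ * g (r θ * cos θ) / r θ| ≤ 1 / 2)
    (hd : ∀ θ, HasDerivAt r
      (ε * (cos θ * g (r θ * cos θ) / (1 - ε * sin θ * g (r θ * cos θ) / r θ))) θ) :
    ∃ φ, IsPeriodicOrbit (lien ε g) φ ∧
      range φ = range (fun θ => (r θ * sin θ, r θ * cos θ)) := by
  set Ω : ℝ → ℝ := fun θ => 1 - ε * sin θ * g (r θ * cos θ) / r θ with hΩdef
  have hrc : Continuous r := continuous_iff_continuousAt.2 fun t => (hd t).continuousAt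
  have hΩc : Continuous Ω := by
    apply Continuous.sub continuous_const
    apply Continuous.div (by fun_prop) hrc
    intro θ; exact (hr θ).ne'
  have hΩl : ∀ θ, 1 / 2 ≤ Ω θ := fun θ => by
    have := (abs_le.1 (hΩ θ)).2; simp only [hΩdef]; linarith
  have hΩu : ∀ θ, Ω θ ≤ 2 := fun θ => by
    have := (abs_le.1 (hΩ θ)).1; simp only [hΩdef]; linarith
  have hΩp : Function.Periodic Ω (2 * π) := by
    intro θ; simp only [hΩdef]; rw [hper θ, sin_add_two_pi, cos_add_two_pi]
  obtain ⟨T, hT, ϑ, hsurj, hϑ, hϑp⟩ := inv_time (fun θ => (Ω θ)⁻¹)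
    (hΩc.inv₀ (fun θ => by linarith [hΩl θ]))
    (fun θ => by
      rw [one_div]
      exact inv_anti₀ (by linarith [hΩl θ]) (hΩu θ))
    (fun θ => by simp only; rw [hΩp θ])
  simp only [inv_inv] at hϑ
  have hrange : range (fun t => (r (ϑ t) * sin (ϑ t), r (ϑ t) * cos (ϑ t)))
      = range (fun θ => (r θ * sin θ, r θ * cos θ)) :=
    hsurj.range_comp (fun θ => (r θ * sin θ, r θ * cos θ))
  have hsol : IsSolution (lien ε g) (fun t => (r (ϑ t) * sin (ϑ t), r (ϑ t) * cos (ϑ t))) := by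
    intro t
    have h1 : HasDerivAt (fun t => r (ϑ t)) _ t := HasDerivAt.comp t (hd (ϑ t)) (hϑ t)
    have h2 := (h1.mul (hϑ t).sin).prodMk (h1.mul (hϑ t).cos)
    refine h2.congr_deriv ?_
    have h3 : Ω (ϑ t) ≠ 0 := by linarith [hΩl (ϑ t)]
    have h5 := (hr (ϑ t)).ne'
    have h4 : r (ϑ t) * Ω (ϑ t) = r (ϑ t) - ε * sin (ϑ t) * g (r (ϑ t) * cos (ϑ t)) := by
      simp only [hΩdef]; field_simp
    have h6 : ε * (cos (ϑ t) * g (r (ϑ t) * cos (ϑ t)) / Ω (ϑ t)) * Ω (ϑ t)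
      = ε * (cos (ϑ t) * g (r (ϑ t) * cos (ϑ t))) := by field_simp
    have h7 := sin_sq_add_cos_sq (ϑ t)
    simp only [lien, Prod.mk.injEq]
    change ε * (cos (ϑ t) * g (r (ϑ t) * cos (ϑ t)) / Ω (ϑ t)) * Ω (ϑ t) * _ + _ = _ ∧
      ε * (cos (ϑ t) * g (r (ϑ t) * cos (ϑ t)) / Ω (ϑ t)) * Ω (ϑ t) * _ + _ = _
    rw [h6]
    constructor
    · linear_combination cos (ϑ t) * h4
    · linear_combination (-sin (ϑ t)) * h4 + ε * g (r (ϑ t) * cos (ϑ t)) * h7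
  refine ⟨_, ⟨hsol, ⟨T, hT, ?_⟩, ?_⟩, hrange⟩
  · intro t
    simp only [hϑp, hper (ϑ t), sin_add_two_pi, cos_add_two_pi]
  · rintro ⟨c, hc⟩
    have e1 : ∀ θ, (r θ * sin θ, r θ * cos θ) = c := by
      intro θ
      obtain ⟨t, rfl⟩ := hsurj θ
      exact hc t
    have e2 := (e1 0).trans (e1 π).symm
    simp only [sin_zero, cos_zero, sin_pi, cos_pi, Prod.mk.injEq] at e2
    have := hr 0
    have := hr π
    linarith [e2.2]

def Rad (k : ℝ) (p q : ℝ → ℝ) (ε u θ : ℝ) : ℝ := k + u + ε * (q θ + u * p θ)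

def Phi (g : ℝ → ℝ) (k : ℝ) (p q dp dq : ℝ → ℝ) (ε u θ : ℝ) : ℝ :=
  (cos θ * g (Rad k p q ε u θ * cos θ) /
    (1 - ε * sin θ * g (Rad k p q ε u θ * cos θ) / Rad k p q ε u θ) - dq θ - u * dp θ)
    / (1 + ε * p θ)

lemma quad_bound (A d X : ℝ) (h : |X - A * d| ≤ |A| / 2 * |d|) :
    A ^ 2 / 2 * d ^ 2 ≤ A * d * X := by
  have h1 : |(A * d) * (X - A * d)| ≤ |A * d| * (|A| / 2 * |d|) := by
    rw [abs_mul]; exact mul_le_mul_of_nonneg_left h (abs_nonneg _)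
  have h2 : |A * d| * (|A| / 2 * |d|) = A ^ 2 / 2 * d ^ 2 := by
    rw [abs_mul, ← sq_abs A, ← sq_abs d]; ring
  rw [h2, abs_le] at h1
  nlinarith [h1.1]

lemma cycle (g : ℝ → ℝ) (k A δ ε : ℝ) (p q dp dq : ℝ → ℝ) (hg : Continuous g)
    (hp : ∀ θ, HasDerivAt p (dp θ) θ) (hq : ∀ θ, HasDerivAt q (dq θ) θ)
    (hpp : Function.Periodic p (2 * π)) (hqp : Function.Periodic q (2 * π))
    (hdpp : Function.Periodic dp (2 * π)) (hdqp : Function.Periodic dq (2 * π))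
    (hε : 0 < ε) (hA : A ≠ 0) (hδ : 0 < δ) (hδk : δ < k)
    (hcont : ContinuousOn (fun z : ℝ × ℝ => Phi g k p q dp dq ε z.1 z.2) (Icc (-δ) δ ×ˢ univ))
    (hlip : ∀ θ, ∀ u ∈ Icc (-δ) δ, ∀ v ∈ Icc (-δ) δ,
      |Phi g k p q dp dq ε v θ - Phi g k p q dp dq ε u θ - A * (v - u)| ≤ |A| / 2 * |v - u|)
    (h0 : ∀ θ, |Phi g k p q dp dq ε 0 θ| ≤ |A| / 2 * (δ / 4))
    (hps : ∀ θ, |ε * p θ| ≤ 1 / 4) (hqs : ∀ θ, |ε * q θ| ≤ δ / 8)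
    (hΩ : ∀ r, |r - k| ≤ δ → ∀ θ, |ε * sin θ * g (r * cos θ) / r| ≤ 1 / 2) :
    ∃ φ, IsLimitCycle (lien ε g) φ ∧
      ∀ t, |√((φ t).1 ^ 2 + (φ t).2 ^ 2) - k| < δ := by
  have hsub : Icc (-(δ / 4)) (δ / 4) ⊆ Icc (-δ) δ := Icc_subset_Icc (by linarith) (by linarith)
  obtain ⟨w, hw⟩ := exists_strip (fun u θ => ε * Phi g k p q dp dq ε u θ) (δ / 4) (ε * A)
    (by linarith) (mul_ne_zero hε.ne' hA)
    (by
      have h1 : ContinuousOn (fun z : ℝ × ℝ => ε * Phi g k p q dp dq ε z.1 z.2)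
        (Icc (-(δ / 4)) (δ / 4) ×ˢ univ) :=
        (hcont.mono (prod_mono hsub (subset_refl _))).const_smul ε
      exact h1)
    (by
      intro θ u hu v hv
      have h1 := mul_le_mul_of_nonneg_left (hlip θ u (hsub hu) v (hsub hv)) hε.le
      rw [abs_mul ε, abs_of_pos hε]
      have h2 : ε * Phi g k p q dp dq ε v θ - ε * Phi g k p q dp dq ε u θ - ε * A * (v - u)
        = ε * (Phi g k p q dp dq ε v θ - Phi g k p q dp dq ε u θ - A * (v - u)) := by ring
      rw [h2, abs_mul, abs_of_pos hε]
      linarith)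
    (by
      intro θ
      have h1 := mul_le_mul_of_nonneg_left (h0 θ) hε.le
      rw [abs_mul, abs_mul, abs_of_pos hε]
      linarith)
  have hA2 : 0 < A ^ 2 := by positivity
  have hwb : ∀ θ, |w θ| ≤ δ / 4 := fun θ => abs_le.2 (hw θ).1
  have hppos : ∀ θ, 3 / 4 ≤ 1 + ε * p θ := fun θ => by
    have := (abs_le.1 (hps θ)).1; linarith
  have hPhip : ∀ u θ, Phi g k p q dp dq ε u (θ + 2 * π) = Phi g k p q dp dq ε u θ := by
    intro u θ
    simp only [Phi, Rad, hpp θ, hqp θ, hdpp θ, hdqp θ, sin_add_two_pi, cos_add_two_pi]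
  -- periodicity
  have hwper : Function.Periodic w (2 * π) := by
    intro θ
    have h1 := decay_zero' (fun θ => w (θ + 2 * π) - w θ)
      (fun θ => ε * Phi g k p q dp dq ε (w (θ + 2 * π)) (θ + 2 * π) -
        ε * Phi g k p q dp dq ε (w θ) θ) A (ε * (A ^ 2 / 2)) δ hA (by positivity)
      (fun θ => ((hw (θ + 2 * π)).2.comp_add_const θ (2 * π)).sub (hw θ).2)
      (fun θ => by
        have a1 := abs_le.1 (hwb θ)
        have a2 := abs_le.1 (hwb (θ + 2 * π))
        rw [abs_le]; constructor <;> linarith [a1.1, a1.2, a2.1, a2.2])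
      (fun θ => by
        have h2 := quad_bound A _ _ (hlip θ (w θ) (hsub (hw θ).1) (w (θ + 2 * π))
          (hsub (hw _).1))
        have h3 := mul_le_mul_of_nonneg_left h2 hε.le
        simp only [hPhip]
        linarith) θ
    linarith
  set r : ℝ → ℝ := fun θ => Rad k p q ε (w θ) θ with hr
  have hrk : ∀ θ, |r θ - k| < δ / 2 := by
    intro θ
    have h1 : r θ - k = w θ + (w θ * (ε * p θ) + ε * q θ) := by simp only [hr, Rad]; ring
    have h2 : |w θ * (ε * p θ)| ≤ δ / 4 * (1 / 4) := by
      rw [abs_mul]; exact mul_le_mul (hwb θ) (hps θ) (abs_nonneg _) (by linarith)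
    rw [h1]
    have h3 := abs_add_le (w θ) (w θ * (ε * p θ) + ε * q θ)
    have h4 := abs_add_le (w θ * (ε * p θ)) (ε * q θ)
    have := hwb θ
    have := hqs θ
    linarith
  have hrpos : ∀ θ, 0 < r θ := fun θ => by have := (abs_lt.1 (hrk θ)).1; linarith
  have hrper : Function.Periodic r (2 * π) := by
    intro θ; simp only [hr, Rad, hwper θ, hpp θ, hqp θ]
  have hrd : ∀ θ, HasDerivAt r
      (ε * (cos θ * g (r θ * cos θ) / (1 - ε * sin θ * g (r θ * cos θ) / r θ))) θ := by
    intro θ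
    have h1 : HasDerivAt r _ θ :=
      ((hw θ).2.const_add k).add (((hq θ).add ((hw θ).2.mul (hp θ))).const_mul ε)
    refine h1.congr_deriv ?_
    have h2 : 1 + ε * p θ ≠ 0 := by linarith [hppos θ]
    have h3 : Phi g k p q dp dq ε (w θ) θ * (1 + ε * p θ) =
        cos θ * g (r θ * cos θ) / (1 - ε * sin θ * g (r θ * cos θ) / r θ) - dq θ - w θ * dp θ := by
      simp only [Phi]; rw [div_mul_cancel₀ _ h2]
    linear_combination ε * h3
  obtain ⟨φ, hφ, hφr⟩ := construct ε g r hg hrpos hrper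
    (fun θ => hΩ _ (by linarith [hrk θ]) θ) hrd
  have hφn : ∀ t, |√((φ t).1 ^ 2 + (φ t).2 ^ 2) - k| < δ / 2 := by
    intro t
    have : φ t ∈ range φ := mem_range_self t
    rw [hφr] at this
    obtain ⟨θ, hθ⟩ := this
    rw [← hθ]
    have h1 : (r θ * sin θ) ^ 2 + (r θ * cos θ) ^ 2 = r θ ^ 2 := by
      linear_combination r θ ^ 2 * sin_sq_add_cos_sq θ
    simp only [h1, sqrt_sq (hrpos θ).le]
    exact hrk θ
  refine ⟨φ, ⟨hφ, {z | |√(z.1 ^ 2 + z.2 ^ 2) - k| < δ / 2}, ?_, ?_, ?_⟩, fun t => by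
    linarith [hφn t]⟩
  · exact isOpen_lt (by fun_prop) continuous_const
  · rintro _ ⟨t, rfl⟩; exact hφn t
  intro ψ hψ hψU
  have hU : ∀ t, |√((ψ t).1 ^ 2 + (ψ t).2 ^ 2) - k| < δ / 2 := fun t => hψU (mem_range_self t)
  have hx : ∀ t, HasDerivAt (fun t => (ψ t).1) (ψ t).2 t := fun t => (hψ.1 t).fst
  have hy : ∀ t, HasDerivAt (fun t => (ψ t).2) (-(ψ t).1 + ε * g (ψ t).2) t :=
    fun t => (hψ.1 t).snd
  have hψc : Continuous ψ := continuous_iff_continuousAt.2 fun t => (hψ.1 t).continuousAt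
  obtain ⟨θ, hθ⟩ := polar_lift (fun t => (ψ t).1) (fun t => (ψ t).2) _ _ hx hy
    (by fun_prop) (by fun_prop) (fun t => by
      have h1 := (abs_lt.1 (hU t)).1
      exact sqrt_pos.1 (by linarith))
  set ρ : ℝ → ℝ := fun t => √((ψ t).1 ^ 2 + (ψ t).2 ^ 2) with hρ
  have hρpos : ∀ t, 0 < ρ t := fun t => by
    have h1 := (abs_lt.1 (hU t)).1; simp only [hρ]; linarith
  have hρsq : ∀ t, (ψ t).1 ^ 2 + (ψ t).2 ^ 2 = ρ t ^ 2 := fun t => (sq_sqrt (by positivity)).symm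
  have hX : ∀ t, (ψ t).1 = ρ t * sin (θ t) := fun t => (hθ t).2.1
  have hY : ∀ t, (ψ t).2 = ρ t * cos (θ t) := fun t => (hθ t).2.2.1
  set W : ℝ → ℝ := fun t => 1 - ε * sin (θ t) * g (ρ t * cos (θ t)) / ρ t with hW
  have hWl : ∀ t, 1 / 2 ≤ W t := fun t => by
    have h1 := (abs_le.1 (hΩ (ρ t) (by linarith [hU t]) (θ t))).2
    simp only [hW]; linarith
  have hθd : ∀ t, HasDerivAt θ (W t) t := by
    intro t
    refine (hθ t).1.congr_deriv ?_
    rw [hρsq t, hX t, hY t]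
    have h1 := (hρpos t).ne'
    simp only [hW]
    field_simp
    linear_combination ρ t * sin_sq_add_cos_sq (θ t)
  have hρd : ∀ t, HasDerivAt ρ (ε * (cos (θ t) * g (ρ t * cos (θ t)))) t := by
    intro t
    refine (hθ t).2.2.2.congr_deriv ?_
    change _ / ρ t = _
    rw [hX t, hY t]
    have h1 := (hρpos t).ne'
    field_simp
    ring
  set u : ℝ → ℝ := fun t => (ρ t - k - ε * q (θ t)) / (1 + ε * p (θ t)) with hu
  have hρu : ∀ t, ρ t = Rad k p q ε (u t) (θ t) := by
    intro t
    have h2 : 1 + ε * p (θ t) ≠ 0 := by linarith [hppos (θ t)]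
    have h3 : u t * (1 + ε * p (θ t)) = ρ t - k - ε * q (θ t) := by
      simp only [hu]; rw [div_mul_cancel₀ _ h2]
    simp only [Rad]; linear_combination -h3
  have hum : ∀ t, u t ∈ Icc (-δ) δ := by
    intro t
    have h2 := hppos (θ t)
    have h3 := abs_lt.1 (hU t)
    have h4 := abs_le.1 (hqs (θ t))
    have h5 : 0 < 1 + ε * p (θ t) := by linarith
    change -(δ / 2) < ρ t - k ∧ ρ t - k < δ / 2 at h3
    constructor
    · simp only [hu]; rw [le_div_iff₀ h5]; nlinarith [h3.1, h3.2, h4.1, h4.2]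
    · simp only [hu]; rw [div_le_iff₀ h5]; nlinarith [h3.1, h3.2, h4.1, h4.2]
  have hud : ∀ t, HasDerivAt u (ε * W t * Phi g k p q dp dq ε (u t) (θ t)) t := by
    intro t
    have h2 : 1 + ε * p (θ t) ≠ 0 := by linarith [hppos (θ t)]
    have h1 : HasDerivAt u _ t := (((hρd t).sub_const k).sub
      ((HasDerivAt.comp t (hq (θ t)) (hθd t)).const_mul ε)).div
      (((HasDerivAt.comp t (hp (θ t)) (hθd t)).const_mul ε).const_add 1) h2
    refine h1.congr_deriv ?_
    have h3 : u t * (1 + ε * p (θ t)) = ρ t - k - ε * q (θ t) := by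
      simp only [hu]; rw [div_mul_cancel₀ _ h2]
    have hW0 : W t ≠ 0 := by linarith [hWl t]
    have h4 : Phi g k p q dp dq ε (u t) (θ t) = (cos (θ t) * g (ρ t * cos (θ t)) / W t
        - dq (θ t) - u t * dp (θ t)) / (1 + ε * p (θ t)) := by
      simp only [Phi, ← hρu t, hW]
    rw [h4]
    simp only [Function.comp, Pi.sub_apply]
    rw [← h3]
    field_simp
  have hdz : ∀ t, u t - w (θ t) = 0 := by
    intro t
    refine decay_zero' (fun t => u t - w (θ t)) (fun t => ε * W t * Phi g k p q dp dq ε (u t) (θ t)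
      - ε * Phi g k p q dp dq ε (w (θ t)) (θ t) * W t) A (ε * (A ^ 2 / 4)) (2 * δ) hA
      (by positivity) (fun t => (hud t).sub (HasDerivAt.comp t (hw (θ t)).2 (hθd t)))
      (fun t => ?_) (fun t => ?_) t
    · have a1 := hum t
      have a2 := hsub (hw (θ t)).1
      rw [abs_le]; constructor <;> linarith [a1.1, a1.2, a2.1, a2.2]
    · have h2 := quad_bound A _ _ (hlip (θ t) (w (θ t)) (hsub (hw _).1) (u t) (hum t))
      have h3 := mul_le_mul_of_nonneg_left h2 (show 0 ≤ ε * W t by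
        have := hWl t; positivity)
      have h4 : ε * (A ^ 2 / 4) * (u t - w (θ t)) ^ 2 ≤
          ε * W t * (A ^ 2 / 2 * (u t - w (θ t)) ^ 2) := by
        have h5 : 0 ≤ ε * (A ^ 2 / 2 * (u t - w (θ t)) ^ 2) := by positivity
        nlinarith [hWl t]
      linarith
  have hψθ : ∀ t, ψ t = (r (θ t) * sin (θ t), r (θ t) * cos (θ t)) := by
    intro t
    have h1 : ρ t = r (θ t) := by
      rw [hρu t, show u t = w (θ t) by linarith [hdz t]]
    rw [← h1, ← hX t, ← hY t]
  have hsurj := surj_of_deriv θ W hθd hWl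
  rw [hφr, ← hsurj.range_comp (fun θ => (r θ * sin θ, r θ * cos θ))]
  congr 1
  funext t
  exact hψθ t

lemma all_of_Icc (Q : ℝ → Prop) (hper : ∀ θ, Q (θ + 2 * π) ↔ Q θ)
    (h : ∀ θ ∈ Icc 0 (2 * π), Q θ) (θ : ℝ) : Q θ := by
  have h1 : Function.Periodic Q (2 * π) := fun θ => propext (hper θ)
  obtain ⟨y, hy, hxy⟩ := h1.exists_mem_Ico₀ (by positivity) θ
  rw [hxy]
  exact h y ⟨hy.1, hy.2.le⟩

lemma tube (f : ℝ × ℝ → ℝ) (hf : ∀ θ, ContinuousAt f (0, θ)) (h0 : ∀ θ, f (0, θ) = 0)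
    (hper : ∀ ε θ, f (ε, θ + 2 * π) = f (ε, θ)) (c : ℝ) (hc : 0 < c) :
    ∀ᶠ ε in nhds (0:ℝ), ∀ θ, |f (ε, θ)| ≤ c := by
  have h1 : ∀ᶠ ε in nhds (0:ℝ), ∀ θ ∈ Icc 0 (2 * π), |f (ε, θ)| ≤ c := by
    apply isCompact_Icc.eventually_forall_of_forall_eventually
    intro θ _
    have h2 : Filter.Tendsto (fun z => |f z|) (nhds (0, θ)) (nhds |f (0, θ)|) := (hf θ).abs
    rw [h0, abs_zero] at h2
    filter_upwards [h2.eventually_lt_const hc] with z hz using hz.le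
  filter_upwards [h1] with ε hε
  exact all_of_Icc _ (fun θ => by rw [hper]) hε

lemma uniform (g : ℝ → ℝ) (k A η : ℝ) (p q dp dq : ℝ → ℝ) (hg : ContDiff ℝ 1 g)
    (hp : ∀ θ, HasDerivAt p (dp θ) θ) (hq : ∀ θ, HasDerivAt q (dq θ) θ)
    (hpc : ContDiff ℝ 1 p) (hqc : ContDiff ℝ 1 q)
    (hdpc : ContDiff ℝ 1 dp) (hdqc : ContDiff ℝ 1 dq)
    (hpp : Function.Periodic p (2 * π)) (hqp : Function.Periodic q (2 * π))
    (hdq : ∀ θ, dq θ = cos θ * g (k * cos θ))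
    (hdp : ∀ θ, dp θ = cos θ ^ 2 * deriv g (k * cos θ) - A)
    (hk : 0 < k) (hA : A ≠ 0) (hη : 0 < η) :
    ∀ᶠ ε in nhdsWithin (0:ℝ) (Ioi 0), ∃ φ, IsLimitCycle (lien ε g) φ ∧
      ∀ t, |√((φ t).1 ^ 2 + (φ t).2 ^ 2) - k| < η := by
  have hdpp : Function.Periodic dp (2 * π) := by
    intro θ; rw [hdp, hdp, cos_add_two_pi]
  have hdqp : Function.Periodic dq (2 * π) := by
    intro θ; rw [hdq, hdq, cos_add_two_pi]
  have hPhip : ∀ ε u θ, Phi g k p q dp dq ε u (θ + 2 * π) = Phi g k p q dp dq ε u θ := by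
    intro ε u θ
    simp only [Phi, Rad, hpp θ, hqp θ, hdpp θ, hdqp θ, sin_add_two_pi, cos_add_two_pi]
  set Ψ : (ℝ × ℝ) × ℝ → ℝ := fun z => Phi g k p q dp dq z.1.1 z.1.2 z.2 with hΨ
  have hΨ0 : ∀ u θ, Ψ ((0, u), θ) = cos θ * g ((k + u) * cos θ) - dq θ - u * dp θ := by
    intro u θ; simp [hΨ, Phi, Rad]
  have hC : ∀ θ, ContDiffAt ℝ 1 Ψ ((0, 0), θ) := by
    intro θ
    have hR : ContDiffAt ℝ 1 (fun z : (ℝ × ℝ) × ℝ => Rad k p q z.1.1 z.1.2 z.2) ((0, 0), θ) := by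
      unfold Rad; fun_prop
    have hG : ContDiffAt ℝ 1 (fun z : (ℝ × ℝ) × ℝ => g (Rad k p q z.1.1 z.1.2 z.2 * cos z.2))
        ((0, 0), θ) := by
      apply ContDiffAt.fun_comp _ hg.contDiffAt
      exact hR.mul (by fun_prop)
    simp only [hΨ, Phi]
    apply ContDiffAt.div
    · apply ContDiffAt.sub
      · apply ContDiffAt.sub
        · apply ContDiffAt.div
          · exact ContDiffAt.mul (by fun_prop) hG
          · apply ContDiffAt.sub contDiffAt_const
            apply ContDiffAt.div
            · exact ContDiffAt.mul (by fun_prop) hG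
            · exact hR
            · simp [Rad, hk.ne']
          · simp
        · fun_prop
      · fun_prop
    · fun_prop
    · simp
  have hS : ∀ θ, HasStrictFDerivAt Ψ (fderiv ℝ Ψ ((0, 0), θ)) ((0, 0), θ) := fun θ =>
    (hC θ).hasStrictFDerivAt one_ne_zero
  have hval : ∀ θ, fderiv ℝ Ψ ((0, 0), θ) ((0, 1), 0) = A := by
    intro θ
    have h1 : HasDerivAt (fun u : ℝ => (((0:ℝ), u), θ)) ((0, 1), 0) 0 :=
      ((hasDerivAt_const (0:ℝ) (0:ℝ)).prodMk (hasDerivAt_id (0:ℝ))).prodMk (hasDerivAt_const _ θ)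
    have h2 := (hS θ).hasFDerivAt.comp_hasDerivAt (0:ℝ) h1
    have h3 : HasDerivAt (Ψ ∘ fun u : ℝ => (((0:ℝ), u), θ)) A 0 := by
      have h4 : (Ψ ∘ fun u : ℝ => (((0:ℝ), u), θ)) =
          fun u => cos θ * g ((k + u) * cos θ) - dq θ - u * dp θ := by
        funext u; exact hΨ0 u θ
      rw [h4]
      have h5 : HasDerivAt (fun u => (k + u) * cos θ) (1 * cos θ) 0 :=
        ((hasDerivAt_id (0:ℝ)).const_add k).mul_const _
      have h6 : HasDerivAt g (deriv g ((k + 0) * cos θ)) ((k + 0) * cos θ) :=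
        (hg.differentiable one_ne_zero _).hasDerivAt
      have h7 := (((HasDerivAt.comp (0:ℝ) h6 h5).const_mul (cos θ)).sub_const (dq θ)).sub
        ((hasDerivAt_id (0:ℝ)).mul_const (dp θ))
      refine h7.congr_deriv ?_
      rw [hdp, add_zero]; ring
    exact h2.unique h3
  -- uniform Lipschitz / continuity
  have hQ : ∀ᶠ e in nhds ((0:ℝ), (0:ℝ), (0:ℝ)), ∀ θ ∈ Icc 0 (2 * π),
      (ContinuousAt Ψ ((e.1, e.2.1), θ) ∧
      |Ψ ((e.1, e.2.2), θ) - Ψ ((e.1, e.2.1), θ) - A * (e.2.2 - e.2.1)|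
        ≤ |A| / 2 * |e.2.2 - e.2.1|) := by
    apply isCompact_Icc.eventually_forall_of_forall_eventually
    intro θ _
    apply Filter.Eventually.and
    · have h1 : ∀ᶠ z in nhds (((0:ℝ), (0:ℝ)), θ), ContinuousAt Ψ z := by
        filter_upwards [(hC θ).eventually (by simp)] with z hz using hz.continuousAt
      have h2 : Filter.Tendsto (fun z : (ℝ × ℝ × ℝ) × ℝ => ((z.1.1, z.1.2.1), z.2))
          (nhds ((0, 0, 0), θ)) (nhds (((0:ℝ), (0:ℝ)), θ)) := by
        have : Continuous (fun z : (ℝ × ℝ × ℝ) × ℝ => ((z.1.1, z.1.2.1), z.2)) := by fun_prop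
        exact this.tendsto ((0, 0, 0), θ)
      exact h2.eventually h1
    · have h1 := (hS θ).isLittleO.def (show 0 < |A| / 2 by positivity)
      have h2 : Filter.Tendsto (fun z : (ℝ × ℝ × ℝ) × ℝ =>
          (((z.1.1, z.1.2.2), z.2), ((z.1.1, z.1.2.1), z.2)))
          (nhds ((0, 0, 0), θ)) (nhds ((((0:ℝ), (0:ℝ)), θ), (((0:ℝ), (0:ℝ)), θ))) := by
        have : Continuous (fun z : (ℝ × ℝ × ℝ) × ℝ =>
          (((z.1.1, z.1.2.2), z.2), ((z.1.1, z.1.2.1), z.2))) := by fun_prop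
        exact this.tendsto ((0, 0, 0), θ)
      filter_upwards [h2.eventually h1] with z hz
      have h3 : ((((z.1.1, z.1.2.2), z.2) : (ℝ × ℝ) × ℝ) - ((z.1.1, z.1.2.1), z.2))
          = (z.1.2.2 - z.1.2.1) • ((0, 1), 0) := by
        simp
      simp only [h3, map_smul, hval, norm_smul, norm_eq_abs, smul_eq_mul] at hz
      have h4 : ‖((((0:ℝ), (1:ℝ)), (0:ℝ)) : (ℝ × ℝ) × ℝ)‖ = 1 := by
        simp [Prod.norm_def]
      rw [h4, mul_one, mul_comm _ A] at hz
      exact hz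
  obtain ⟨δ1, hδ1, hQ⟩ := Metric.eventually_nhds_iff.1 hQ
  obtain ⟨δ, hδ, hδδ1, hδk, hδη⟩ : ∃ δ > 0, δ < δ1 ∧ δ < k ∧ δ < η := by
    refine ⟨min δ1 (min k η) / 2, by positivity, ?_, ?_, ?_⟩
    · have h1 := min_le_left δ1 (min k η); linarith
    · have h1 := (min_le_right δ1 (min k η)).trans (min_le_left k η)
      linarith
    · have h1 := (min_le_right δ1 (min k η)).trans (min_le_right k η)
      linarith
  have E0 := tube (fun z => Ψ ((z.1, 0), z.2)) (fun θ => by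
      apply ContinuousAt.comp (f := fun z : ℝ × ℝ => ((z.1, (0:ℝ)), z.2)) (g := Ψ)
      · exact (hC θ).continuousAt
      · fun_prop)
    (fun θ => by simp [hΨ0, hdq]) (fun ε θ => hPhip _ _ _) (|A| / 2 * (δ / 4)) (by positivity)
  have E1 := tube (fun z => z.1 * p z.2) (fun θ => by
    have := hpc.continuous; fun_prop) (by simp) (fun ε θ => by simp [hpp θ]) (1 / 4) (by norm_num)
  have E2 := tube (fun z => z.1 * q z.2) (fun θ => by
    have := hqc.continuous; fun_prop) (by simp) (fun ε θ => by simp [hqp θ]) (δ / 8) (by positivity)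
  have E3 : ∀ᶠ ε in nhds (0:ℝ), ∀ y ∈ Icc (k - δ) (k + δ) ×ˢ Icc 0 (2 * π),
      |ε * sin y.2 * g (y.1 * cos y.2) / y.1| ≤ 1 / 2 := by
    apply (isCompact_Icc.prod isCompact_Icc).eventually_forall_of_forall_eventually
    rintro ⟨r, θ⟩ ⟨hr, _⟩
    have hr0 : r ≠ 0 := by have := hr.1; simp only at this; linarith
    have hgc := hg.continuous
    have h2 : ContinuousAt (fun z : ℝ × ℝ × ℝ => |z.1 * sin z.2.2 * g (z.2.1 * cos z.2.2) / z.2.1|)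
        (0, r, θ) := by
      apply ContinuousAt.abs
      apply ContinuousAt.div (by fun_prop) (by fun_prop) hr0
    have h3 := h2.eventually_lt_const (show _ < (1 / 2 : ℝ) by simp)
    filter_upwards [h3] with z hz using hz.le
  have E4 : ∀ᶠ ε in nhds (0:ℝ), |ε| < δ1 := by
    have : ContinuousAt (fun ε : ℝ => |ε|) 0 := by fun_prop
    exact this.eventually_lt_const (by simpa using hδ1)
  have E := (((E0.and E1).and E2).and E3).and E4
  filter_upwards [E.filter_mono nhdsWithin_le_nhds, self_mem_nhdsWithin] with ε hE hε
  obtain ⟨⟨⟨⟨e0, e1⟩, e2⟩, e3⟩, e4⟩ := hE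
  have hQ' : ∀ u ∈ Icc (-δ) δ, ∀ v ∈ Icc (-δ) δ, ∀ θ, (ContinuousAt Ψ ((ε, u), θ) ∧
      |Ψ ((ε, v), θ) - Ψ ((ε, u), θ) - A * (v - u)| ≤ |A| / 2 * |v - u|) := by
    intro u hu v hv
    have h1 := hQ (y := (ε, u, v)) (by
      have a1 := (abs_le.2 hu).trans_lt hδδ1
      have a2 := (abs_le.2 hv).trans_lt hδδ1
      simp [Prod.dist_eq, e4, a1, a2])
    refine all_of_Icc _ (fun θ => ?_) h1
    have h2 : ContinuousAt Ψ ((ε, u), θ + 2 * π) ↔ ContinuousAt Ψ ((ε, u), θ) := by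
      have h3 := (Homeomorph.addRight (((0:ℝ), (0:ℝ)), 2 * π)).comp_continuousAt_iff' Ψ ((ε, u), θ)
      have h4 : Ψ ∘ (Homeomorph.addRight (((0:ℝ), (0:ℝ)), 2 * π)) = Ψ := by
        funext z
        simp [hΨ, hPhip]
      rw [h4] at h3
      rw [h3]; simp
    have h5 : ∀ u, Ψ ((ε, u), θ + 2 * π) = Ψ ((ε, u), θ) := fun u => hPhip _ _ _
    rw [h2, h5, h5]
  obtain ⟨φ, hφ, hφk⟩ := cycle g k A δ ε p q dp dq hg.continuous hp hq hpp hqp hdpp hdqp hε hA hδ hδk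
    (by
      rintro ⟨u, θ⟩ ⟨hu, _⟩
      apply ContinuousAt.continuousWithinAt
      have h1 := (hQ' u hu u hu θ).1
      exact ContinuousAt.comp (f := fun z : ℝ × ℝ => ((ε, z.1), z.2)) (g := Ψ) (x := (u, θ)) h1
        (by fun_prop))
    (fun θ u hu v hv => (hQ' u hu v hv θ).2) e0 e1 e2
    (fun r hr => by
      apply all_of_Icc
      · intro θ; rw [sin_add_two_pi, cos_add_two_pi]
      · intro θ hθ
        have h1 := abs_le.1 hr
        exact e3 (r, θ) ⟨⟨by linarith [h1.1], by linarith [h1.2]⟩, hθ⟩)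
  exact ⟨φ, hφ, fun t => (hφk t).trans hδη⟩

lemma avg (j : ℕ) : ∃ c : ℝ, 0 < c ∧ ∃ P : ℝ → ℝ, ContDiff ℝ 1 P ∧ Function.Periodic P (2 * π) ∧
    ∀ θ, HasDerivAt P (cos θ ^ (2 * j) - c) θ := by
  induction j with
  | zero =>
    exact ⟨1, one_pos, fun _ => 0, contDiff_const, fun _ => rfl, fun θ => by
      simpa using hasDerivAt_const θ (0:ℝ)⟩
  | succ j ih =>
    obtain ⟨c, hc, P, hP, hper, hd⟩ := ih
    refine ⟨c * (2 * j + 1) / (2 * j + 2), by positivity,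
      fun θ => (sin θ * cos θ ^ (2 * j + 1) + (2 * j + 1) * P θ) / (2 * j + 2), ?_, ?_, ?_⟩
    · fun_prop
    · intro θ; simp only [sin_add_two_pi, cos_add_two_pi, hper θ]
    · intro θ
      have h1 := (((hasDerivAt_sin θ).mul ((hasDerivAt_cos θ).fun_pow (2 * j + 1))).add
        ((hd θ).const_mul (2 * (j:ℝ) + 1))).div_const (2 * (j:ℝ) + 2)
      refine h1.congr_deriv ?_
      have h2 : (2 * (j:ℝ) + 2) ≠ 0 := by positivity
      field_simp
      push_cast
      have h3 := sin_sq_add_cos_sq θ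
      linear_combination (-(2 * (j:ℝ) + 1) * cos θ ^ (2 * j)) * h3

lemma hasDerivAt_oddpoly {n : ℕ} (b : Fin n → ℝ) (y : ℝ) :
    HasDerivAt (fun y => ∑ j, b j * y ^ (2 * (j:ℕ) + 1))
      (∑ j, b j * ((2 * (j:ℕ) + 1) * y ^ (2 * (j:ℕ)))) y := by
  apply HasDerivAt.fun_sum
  intro j _
  refine ((hasDerivAt_pow (2 * (j:ℕ) + 1) y).const_mul (b j)).congr_deriv ?_
  push_cast; simp

lemma main_g (N : ℕ) : ∃ b : Fin (N + 1) → ℝ, ∀ᶠ ε in nhdsWithin (0:ℝ) (Ioi 0),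
    ∀ i : Fin N, ∃ φ, IsLimitCycle (lien ε (fun y => ∑ j, b j * y ^ (2 * (j:ℕ) + 1))) φ ∧
      ∀ t, |√((φ t).1 ^ 2 + (φ t).2 ^ 2) - ((i:ℕ) + 1 : ℝ)| < 1 / 2 := by
  choose c hc P hPc hPp hPd using avg
  set f : Fin N → ℝ := fun i => ((i:ℕ) + 1 : ℝ) ^ 2 with hf
  set Pol : Polynomial ℝ := ∏ i : Fin N, (Polynomial.X - Polynomial.C (f i)) with hPol
  have hdeg : Pol.natDegree < N + 1 := by
    rw [hPol, Polynomial.natDegree_prod_of_monic _ _ (fun i _ => Polynomial.monic_X_sub_C _)]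
    simp
  have hinj : Function.Injective f := by
    intro i j hij
    simp only [hf] at hij
    have := (sq_eq_sq₀ (by positivity) (by positivity)).1 hij
    have h2 : ((i:ℕ):ℝ) = (j:ℕ) := by linarith
    exact Fin.ext (by exact_mod_cast h2)
  have hsep : Pol.Separable := by
    rw [hPol, Polynomial.separable_prod_X_sub_C_iff]; exact hinj
  have hroot : ∀ i, Pol.eval (f i) = 0 := by
    intro i
    rw [hPol, Polynomial.eval_prod]
    exact Finset.prod_eq_zero (Finset.mem_univ i) (by simp)
  have hder : ∀ i, (Polynomial.derivative Pol).eval (f i) ≠ 0 := by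
    intro i
    have := hsep.aeval_derivative_ne_zero (x := f i) (by simpa using hroot i)
    simpa using this
  have hev : ∀ x, Pol.eval x = ∑ j : Fin (N + 1), Pol.coeff j * x ^ (j:ℕ) := by
    intro x
    rw [Polynomial.eval_eq_sum_range' hdeg, Fin.sum_univ_eq_sum_range (fun j => Pol.coeff j * x ^ j)]
  set b : Fin (N + 1) → ℝ := fun j => Pol.coeff j / c (j + 1) with hb
  have hbc : ∀ j : Fin (N + 1), b j * c (j + 1) = Pol.coeff j := fun j =>
    div_mul_cancel₀ _ (hc _).ne'
  refine ⟨b, ?_⟩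
  rw [Filter.eventually_all]
  intro i
  set k : ℝ := ((i:ℕ) + 1 : ℝ) with hk
  have hkpos : 0 < k := by positivity
  set g : ℝ → ℝ := fun y => ∑ j, b j * y ^ (2 * (j:ℕ) + 1) with hg
  have hgd : ∀ y, deriv g y = ∑ j, b j * ((2 * (j:ℕ) + 1) * y ^ (2 * (j:ℕ))) :=
    fun y => (hasDerivAt_oddpoly b y).deriv
  set A : ℝ := ∑ j : Fin (N + 1), Pol.coeff j * ((2 * (j:ℕ) + 1) * k ^ (2 * (j:ℕ))) with hAdef
  have hfun : (fun r : ℝ => ∑ j : Fin (N + 1), Pol.coeff j * r ^ (2 * (j:ℕ) + 1)) =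
      fun r => r * Pol.eval (r ^ 2) := by
    funext r
    rw [hev, Finset.mul_sum]
    apply Finset.sum_congr rfl
    intro j _
    rw [pow_succ, pow_mul]; ring
  have hM : ∑ j : Fin (N + 1), Pol.coeff j * k ^ (2 * (j:ℕ) + 1) = 0 := by
    have h1 := congrFun hfun k
    rw [h1, show k ^ 2 = f i from rfl, hroot, mul_zero]
  have hA : A = k * ((Polynomial.derivative Pol).eval (k ^ 2) * (2 * k)) := by
    have h1 := hasDerivAt_oddpoly (fun j : Fin (N + 1) => Pol.coeff j) k
    rw [hfun] at h1
    have h2 : HasDerivAt (fun r : ℝ => Pol.eval (r ^ 2)) _ k :=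
      HasDerivAt.comp (h₂ := fun x => Pol.eval x) k (Pol.hasDerivAt (k ^ 2)) (hasDerivAt_pow 2 k)
    have h3 := h1.unique ((hasDerivAt_id k).mul h2)
    rw [hAdef, h3]
    rw [show k ^ 2 = f i from rfl, hroot]
    simp
  have hA0 : A ≠ 0 := by
    rw [hA]
    exact mul_ne_zero hkpos.ne' (mul_ne_zero (hder i) (by positivity))
  have hdq : ∀ θ, cos θ * g (k * cos θ) =
      ∑ j : Fin (N + 1), b j * k ^ (2 * (j:ℕ) + 1) * (cos θ ^ (2 * ((j:ℕ) + 1)) - c (j + 1)) := by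
    intro θ
    have h1 : ∑ j : Fin (N + 1), b j * k ^ (2 * (j:ℕ) + 1) * (cos θ ^ (2 * ((j:ℕ) + 1)) - c (j + 1))
      = ∑ j : Fin (N + 1), b j * k ^ (2 * (j:ℕ) + 1) * cos θ ^ (2 * ((j:ℕ) + 1))
        - ∑ j : Fin (N + 1), Pol.coeff j * k ^ (2 * (j:ℕ) + 1) := by
      rw [← Finset.sum_sub_distrib]
      apply Finset.sum_congr rfl
      intro j _
      rw [← hbc j]; ring
    rw [h1, hM, sub_zero, hg, Finset.mul_sum]
    apply Finset.sum_congr rfl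
    intro j _
    ring
  have hdp : ∀ θ, cos θ ^ 2 * deriv g (k * cos θ) - A =
      ∑ j : Fin (N + 1), b j * ((2 * (j:ℕ) + 1) * k ^ (2 * (j:ℕ))) *
        (cos θ ^ (2 * ((j:ℕ) + 1)) - c (j + 1)) := by
    intro θ
    rw [hgd, hAdef, Finset.mul_sum, ← Finset.sum_sub_distrib]
    apply Finset.sum_congr rfl
    intro j _
    rw [← hbc j]; ring
  refine uniform g k A (1 / 2)
    (fun θ => ∑ j : Fin (N + 1), b j * ((2 * (j:ℕ) + 1) * k ^ (2 * (j:ℕ))) * P (j + 1) θ)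
    (fun θ => ∑ j : Fin (N + 1), b j * k ^ (2 * (j:ℕ) + 1) * P (j + 1) θ)
    (fun θ => cos θ ^ 2 * deriv g (k * cos θ) - A) (fun θ => cos θ * g (k * cos θ))
    ?_ ?_ ?_ ?_ ?_ ?_ ?_ ?_ ?_ (fun _ => rfl) (fun _ => rfl) hkpos hA0 (by norm_num)
  · simp only [hg]; fun_prop
  · intro θ
    simp only [hdp]
    exact HasDerivAt.fun_sum fun j _ => (hPd _ θ).const_mul _
  · intro θ
    simp only [hdq]
    exact HasDerivAt.fun_sum fun j _ => (hPd _ θ).const_mul _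
  · exact ContDiff.sum fun j _ => contDiff_const.mul (hPc _)
  · exact ContDiff.sum fun j _ => contDiff_const.mul (hPc _)
  · simp only [hdp]; fun_prop
  · simp only [hg]; fun_prop
  · intro θ; simp only [hPp _ θ]
  · intro θ; simp only [hPp _ θ]

lemma main_a (n N : ℕ) (h : n = N + 1) : ∃ a : Fin n → ℝ,
    HasAtLeastNLimitCycles (fun p : ℝ × ℝ =>
      ((p.2, -p.1 + ∑ j : Fin n, a j * p.2 ^ (2 * (j : ℕ) + 1)) : ℝ × ℝ)) N := by
  subst h
  obtain ⟨b, hb⟩ := main_g N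
  obtain ⟨ε, hε⟩ := hb.exists
  choose φ hφ hn using hε
  refine ⟨fun j => ε * b j, φ, fun i => ?_, fun i j hij heq => hij ?_⟩
  · have h1 : (fun p : ℝ × ℝ =>
        ((p.2, -p.1 + ∑ j : Fin (N + 1), ε * b j * p.2 ^ (2 * (j : ℕ) + 1)) : ℝ × ℝ)) =
        lien ε (fun y => ∑ j, b j * y ^ (2 * (j:ℕ) + 1)) := by
      funext p
      simp only [lien, Finset.mul_sum, mul_assoc]
    rw [h1]
    exact hφ i
  · have h1 : φ i 0 ∈ range (φ j) := heq ▸ mem_range_self 0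
    obtain ⟨t, ht⟩ := h1
    have h2 := hn i 0
    have h3 := hn j t
    rw [ht] at h3
    rw [abs_lt] at h2 h3
    have h4 : ((i:ℕ):ℝ) < (j:ℕ) + 1 := by linarith [h2.1, h3.2]
    have h5 : ((j:ℕ):ℝ) < (i:ℕ) + 1 := by linarith [h2.2, h3.1]
    have h6 : (i:ℕ) < j + 1 := by exact_mod_cast h4
    have h7 : (j:ℕ) < i + 1 := by exact_mod_cast h5
    exact Fin.ext (by omega)

/-- For every `m ≥ 4` there exist coefficients `a_0, …, a_{m-3}` such that
the classical Liénard system `(ẋ,ẏ) = (y, -x + a_0 y + a_1 y³ + ⋯ + a_{m-3} y^{2m-5})` has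
at least `m - 3` limit cycles. In particular, there is a planar polynomial system whose
right-hand side consists of `m` monomial vector fields and which has at least `m - 3`
limit cycles. -/
theorem statement3 (m : ℕ) (hm : 4 ≤ m) :
    (∃ a : Fin (m - 2) → ℝ,
      HasAtLeastNLimitCycles
        (fun p : ℝ × ℝ =>
          ((p.2, -p.1 + ∑ j : Fin (m - 2), a j * p.2 ^ (2 * (j : ℕ) + 1)) : ℝ × ℝ))
        (m - 3)) ∧
    (∃ (X : Fin m → ℝ × ℝ → ℝ × ℝ) (a : Fin m → ℝ), (∀ j, IsMonomialVF (X j)) ∧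
      HasAtLeastNLimitCycles (fun p : ℝ × ℝ => ∑ j, a j • X j p) (m - 3)) := by
  obtain ⟨N, rfl⟩ : ∃ N, m = N + 3 := ⟨m - 3, by omega⟩
  refine ⟨main_a _ _ (by omega), ?_⟩
  obtain ⟨a, ha⟩ := main_a (N + 1) (N + 3 - 3) (by omega)
  refine ⟨fun j => if (j:ℕ) < N + 1 then fun p => (0, p.1 ^ 0 * p.2 ^ (2 * (j:ℕ) + 1))
      else if (j:ℕ) = N + 1 then fun p => (p.1 ^ 0 * p.2 ^ 1, 0) else fun p => (0, p.1 ^ 1 * p.2 ^ 0),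
    fun j => if h : (j:ℕ) < N + 1 then a ⟨j, h⟩ else if (j:ℕ) = N + 1 then 1 else -1, ?_, ?_⟩
  · intro j
    simp only
    split_ifs
    · exact ⟨0, _, Or.inr rfl⟩
    · exact ⟨0, 1, Or.inl rfl⟩
    · exact ⟨1, 0, Or.inr rfl⟩
  · convert ha using 1
    funext p
    rw [Fin.sum_univ_castSucc, Fin.sum_univ_castSucc]
    have hle : ∀ c : Fin (N + 1), (c:ℕ) ≤ N := fun c => Nat.lt_succ_iff.1 c.2
    ext
    · simp [hle, Prod.fst_sum]
    · simp [hle, Prod.snd_sum]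
      ring
end
end

section
/- There exists a sequence of integers m_k tending to infinity and, for each k, a planar polynomial differential system whose right-hand side consists of m_k monomial vector fields and which has at least L_k limit cycles, where liminf_{k→∞} ( L_k · 2 log 2 ) / ( (m_k - 3) · log((m_k - 3)/2) ) ≥ 1. -/
open Real Set Filter

noncomputable section

/-! ### Scalar periodic ODE -/

lemma scalar_ode (w : ℝ → ℝ) (hc : Continuous w) (hpos : ∀ s, 0 < w s)
    (hper : Function.Periodic w (2 * π)) :
    ∃ θ : ℝ → ℝ, (∀ t, HasDerivAt θ (w (θ t)) t) ∧ Function.Surjective θ ∧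
      ∃ T > 0, ∀ t, θ (t + T) = θ t + 2 * π := by
  set g : ℝ → ℝ := fun s => (w s)⁻¹ with hg
  have hgc : Continuous g := hc.inv₀ (fun s => (hpos s).ne')
  have hgpos : ∀ s, 0 < g s := fun s => inv_pos.mpr (hpos s)
  have hgper : Function.Periodic g (2 * π) := fun s => by simp only [hg, hper s]
  have hgi : ∀ a b, IntervalIntegrable g MeasureTheory.volume a b :=
    fun a b => hgc.intervalIntegrable a b
  set τ : ℝ → ℝ := fun s => ∫ x in (0:ℝ)..s, g x with hτ
  have hτd : ∀ s, HasDerivAt τ (g s) s := fun s => hgc.integral_hasStrictDerivAt 0 s |>.hasDerivAt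
  have hτc : Continuous τ := continuous_iff_continuousAt.mpr fun s => (hτd s).continuousAt
  have hmono : StrictMono τ := by
    apply strictMono_of_deriv_pos
    intro s
    rw [(hτd s).deriv]
    exact hgpos s
  have htop : Tendsto τ atTop atTop :=
    hgper.tendsto_atTop_intervalIntegral_of_pos' (hgi _ _) hgpos two_pi_pos
  have hbot : Tendsto τ atBot atBot :=
    hgper.tendsto_atBot_intervalIntegral_of_pos' (hgi _ _) hgpos two_pi_pos
  have hsurj : Function.Surjective τ := hτc.surjective htop hbot
  let e : ℝ ≃o ℝ := hmono.orderIsoOfSurjective τ hsurj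
  have he : ∀ s, e s = τ s := fun s => rfl
  have hes : ∀ t, τ (e.symm t) = t := fun t => by rw [← he, e.apply_symm_apply]
  refine ⟨e.symm, ?_, e.symm.surjective, τ (2 * π), ?_, ?_⟩
  · intro t
    have := HasDerivAt.of_local_left_inverse (f := τ) (g := e.symm) (a := t)
      e.symm.continuous.continuousAt (hτd _) (hgpos _).ne' (Eventually.of_forall hes)
    simpa [hg] using this
  · exact intervalIntegral.intervalIntegral_pos_of_pos (hgi _ _) hgpos two_pi_pos
  · intro t
    apply hmono.injective
    rw [hes]
    have h2 := hgper.intervalIntegral_add_eq_add 0 (e.symm t) hgi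
    simp only [zero_add] at h2
    have h3 := hes t
    simp only [hτ] at h3 ⊢
    rw [h2, h3]

/-! ### Branches -/

open Polynomial in
/-- A monotone branch of `P` over `(-1,1)`. -/
structure IsBranch (P : ℝ[X]) (a b : ℝ) (p : ℝ → ℝ) : Prop where
  cont : Continuous p
  mem : ∀ u ∈ Ioo (-1:ℝ) 1, p u ∈ Ioo a b
  right : ∀ u ∈ Ioo (-1:ℝ) 1, P.eval (p u) = u
  pos : ∀ x ∈ Ioo a b, 0 < (derivative P).eval x

section
open Polynomial

lemma IsBranch.strictMonoOn {P : ℝ[X]} {a b : ℝ} {p : ℝ → ℝ} (h : IsBranch P a b p) :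
    StrictMonoOn (fun x => P.eval x) (Ioo a b) := by
  apply strictMonoOn_of_deriv_pos (convex_Ioo a b) P.continuous.continuousOn
  intro x hx
  rw [interior_Ioo] at hx
  rw [Polynomial.deriv]
  exact h.pos x hx

lemma IsBranch.hasDerivAt {P : ℝ[X]} {a b : ℝ} {p : ℝ → ℝ} (h : IsBranch P a b p)
    {u : ℝ} (hu : u ∈ Ioo (-1:ℝ) 1) :
    HasDerivAt p ((derivative P).eval (p u))⁻¹ u := by
  apply HasDerivAt.of_local_left_inverse (f := fun x => P.eval x) h.cont.continuousAt
    (P.hasDerivAt _) (h.pos _ (h.mem u hu)).ne'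
  filter_upwards [isOpen_Ioo.mem_nhds hu] with v hv using h.right v hv

lemma IsBranch.zero_pos {P : ℝ[X]} {a b : ℝ} {p : ℝ → ℝ} (h : IsBranch P a b p)
    {y : ℝ} (hy : y ∈ Ioo a b) (hne : y ≠ p 0) :
    0 < (y - p 0) * (P.eval y * (derivative P).eval y) := by
  have h0 : (0:ℝ) ∈ Ioo (-1:ℝ) 1 := by constructor <;> norm_num
  have hm := h.mem 0 h0
  have hr := h.right 0 h0
  have hp := h.pos y hy
  rcases lt_or_gt_of_ne hne with hlt | hlt
  · have := h.strictMonoOn hy hm hlt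
    simp only [hr] at this
    rw [← mul_assoc]
    exact mul_pos (mul_pos_of_neg_of_neg (by linarith) this) hp
  · have := h.strictMonoOn hm hy hlt
    simp only [hr] at this
    rw [← mul_assoc]
    exact mul_pos (mul_pos (by linarith) this) hp

/-- The vector field. -/
def VF (P : ℝ[X]) : ℝ × ℝ → ℝ × ℝ := fun q =>
  (P.eval q.2 * (derivative P).eval q.2,
    -(P.eval q.1 * (derivative P).eval q.1)
      + q.2 * (1/4 - P.eval q.1 ^ 2 - P.eval q.2 ^ 2))

lemma VF_contDiff (P : ℝ[X]) : ContDiff ℝ 1 (VF P) := by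
  have h1 : ∀ Q : ℝ[X], ContDiff ℝ 1 (fun q : ℝ × ℝ => Q.eval q.1) :=
    fun Q => by
      simpa [Function.comp_def] using (Q.contDiff_aeval (𝕜 := ℝ) 1).comp (contDiff_fst (𝕜 := ℝ) (E := ℝ) (F := ℝ))
  have h2 : ∀ Q : ℝ[X], ContDiff ℝ 1 (fun q : ℝ × ℝ => Q.eval q.2) :=
    fun Q => by
      simpa [Function.comp_def] using (Q.contDiff_aeval (𝕜 := ℝ) 1).comp (contDiff_snd (𝕜 := ℝ) (E := ℝ) (F := ℝ))
  unfold VF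
  exact ((h2 _).mul (h2 _)).prodMk
    (((h1 _).mul (h1 _)).neg.add
      (contDiff_snd.mul ((contDiff_const.sub ((h1 _).pow 2)).sub ((h2 _).pow 2))))

/-- Two periodic solutions sharing a point have the same range. -/
lemma range_eq_of_meet {X : ℝ × ℝ → ℝ × ℝ} (hX : ContDiff ℝ 1 X) {φ ψ : ℝ → ℝ × ℝ}
    (hφ : IsPeriodicOrbit X φ) (hψ : IsPeriodicOrbit X ψ) {s t : ℝ} (h : ψ s = φ t) :
    Set.range ψ = Set.range φ := by
  obtain ⟨hφs, ⟨T, hT, hφp⟩, -⟩ := hφ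
  obtain ⟨hψs, ⟨T', hT', hψp⟩, -⟩ := hψ
  have hφc : Continuous φ := continuous_iff_continuousAt.mpr fun s => (hφs s).continuousAt
  have hψc : Continuous ψ := continuous_iff_continuousAt.mpr fun s => (hψs s).continuousAt
  have hK : IsCompact (Set.range φ ∪ Set.range ψ) :=
    (hφp.compact_of_continuous hT.ne' hφc).union (hψp.compact_of_continuous hT'.ne' hψc)
  obtain ⟨K, hL⟩ := LocallyLipschitzOn.exists_lipschitzOnWith_of_compact hK
    (hX.locallyLipschitz.locallyLipschitzOn (s := Set.range φ ∪ Set.range ψ))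
  have key : ψ = fun r => φ (r + (t - s)) := by
    refine ODE_solution_unique_univ (v := fun _ => X) (s := fun _ => Set.range φ ∪ Set.range ψ)
      (t₀ := s) (K := K) (fun _ => hL) (fun r => ⟨hψs r, Or.inr ⟨r, rfl⟩⟩)
      (fun r => ⟨?_, Or.inl ⟨_, rfl⟩⟩) (by simpa using h)
    exact (hφs (r + (t - s))).comp_add_const r (t - s)
  ext q
  constructor
  · rintro ⟨r, rfl⟩
    exact ⟨r + (t - s), by rw [key]⟩
  · rintro ⟨r, rfl⟩
    exact ⟨r - (t - s), by rw [key]; simp⟩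

/-- A periodic orbit in the box lies on the level set. -/
lemma on_level {P : ℝ[X]} {a b c d : ℝ} {p q : ℝ → ℝ}
    (hq : IsBranch P c d q) {ψ : ℝ → ℝ × ℝ} (hψ : IsPeriodicOrbit (VF P) ψ)
    (hU : Set.range ψ ⊆ Ioo a b ×ˢ Ioo c d) (t₀ : ℝ) :
    P.eval (ψ t₀).1 ^ 2 + P.eval (ψ t₀).2 ^ 2 - 1/4 = 0 := by
  obtain ⟨hs, ⟨T, hT, hp⟩, hnc⟩ := hψ
  by_contra hne
  have hx : ∀ t, HasDerivAt (fun t => (ψ t).1) (VF P (ψ t)).1 t := fun t => (hs t).fst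
  have hy : ∀ t, HasDerivAt (fun t => (ψ t).2) (VF P (ψ t)).2 t := fun t => (hs t).snd
  set W : ℝ → ℝ := fun t => (P.eval (ψ t).1 ^ 2 + P.eval (ψ t).2 ^ 2 - 1/4) ^ 2
    * Real.exp (4 * q 0 * (ψ t).1) with hW
  have hWd : ∀ t, HasDerivAt W
      (-(4 * (((ψ t).2 - q 0) * (P.eval (ψ t).2 * (derivative P).eval (ψ t).2)) * W t)) t := by
    intro t
    have h1 : HasDerivAt (fun t => P.eval (ψ t).1)
        ((derivative P).eval (ψ t).1 * (VF P (ψ t)).1) t :=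
      HasDerivAt.comp (h₂ := fun x => P.eval x) t (P.hasDerivAt (ψ t).1) (hx t)
    have h2 : HasDerivAt (fun t => P.eval (ψ t).2)
        ((derivative P).eval (ψ t).2 * (VF P (ψ t)).2) t :=
      HasDerivAt.comp (h₂ := fun x => P.eval x) t (P.hasDerivAt (ψ t).2) (hy t)
    have h3 := ((((h1.pow 2).add (h2.pow 2)).sub_const (1/4)).pow 2).mul
      (((hx t).const_mul (4 * q 0)).exp)
    refine HasDerivAt.congr_deriv (f := W) h3 ?_
    simp only [hW, VF, Pi.add_apply, Pi.pow_apply]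
    push_cast
    ring
  have hb : ∀ t, (ψ t).2 ≠ q 0 →
      0 < ((ψ t).2 - q 0) * (P.eval (ψ t).2 * (derivative P).eval (ψ t).2) := fun t ht =>
    hq.zero_pos (hU ⟨t, rfl⟩).2 ht
  have hb0 : ∀ t, 0 ≤ ((ψ t).2 - q 0) * (P.eval (ψ t).2 * (derivative P).eval (ψ t).2) := by
    intro t
    by_cases h : (ψ t).2 = q 0
    · simp [h]
    · exact (hb t h).le
  have hW0 : ∀ t, 0 ≤ W t := fun t => mul_nonneg (sq_nonneg _) (Real.exp_pos _).le
  have hanti : Antitone W := by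
    apply antitone_of_deriv_nonpos (fun t => (hWd t).differentiableAt)
    intro t
    rw [(hWd t).deriv]
    have := mul_nonneg (hb0 t) (hW0 t)
    linarith
  have hWp : Function.Periodic W T := fun t => by simp only [hW, hp t]
  have hconst : ∀ t, W t = W t₀ := by
    have aux : ∀ s t, W s ≤ W t := by
      intro s t
      obtain ⟨n, hn⟩ := exists_nat_gt ((t - s) / T)
      rw [div_lt_iff₀ hT] at hn
      have h1 : W (s + n * T) = W s := by simpa using hWp.nat_mul n s
      rw [← h1]
      exact hanti (by linarith)
    intro t
    exact le_antisymm (aux _ _) (aux _ _)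
  have hWpos : 0 < W t₀ := mul_pos (by positivity) (Real.exp_pos _)
  have hyc : ∀ t, (ψ t).2 = q 0 := by
    intro t
    by_contra h
    have h1 : HasDerivAt W 0 t := by
      have : W = fun _ => W t₀ := funext hconst
      rw [this]
      exact hasDerivAt_const _ _
    have h2 := (hWd t).unique h1
    have h3 := mul_pos (hb t h) hWpos
    rw [hconst t] at h2
    linarith
  have hq0 : P.eval (q 0) = 0 := hq.right 0 (by constructor <;> norm_num)
  have hxc : ∀ t, (ψ t).1 = (ψ 0).1 := by
    intro t
    apply is_const_of_deriv_eq_zero (f := fun t => (ψ t).1) (fun t => (hx t).differentiableAt)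
    intro t
    rw [(hx t).deriv]
    simp [VF, hyc, hq0]
  exact hnc ⟨((ψ 0).1, q 0), fun t => Prod.ext (hxc t) (hyc t)⟩

lemma half_mem {r : ℝ} (h : |r| ≤ 1) : r / 2 ∈ Ioo (-1:ℝ) 1 := by
  rw [abs_le] at h
  constructor <;> linarith

lemma exists_cycle {P : ℝ[X]} {a b c d : ℝ} {p q : ℝ → ℝ}
    (hp : IsBranch P a b p) (hq : IsBranch P c d q) :
    ∃ φ : ℝ → ℝ × ℝ, IsLimitCycle (VF P) φ ∧ Set.range φ ⊆ Ioo a b ×ˢ Ioo c d := by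
  have hs : ∀ θ : ℝ, Real.sin θ / 2 ∈ Ioo (-1:ℝ) 1 := fun θ => half_mem (abs_sin_le_one θ)
  have hc : ∀ θ : ℝ, Real.cos θ / 2 ∈ Ioo (-1:ℝ) 1 := fun θ => half_mem (abs_cos_le_one θ)
  have hpc := hp.cont
  have hqc := hq.cont
  obtain ⟨θ, hθ, hsurj, T, hT, hθT⟩ := scalar_ode
    (fun s => (derivative P).eval (p (Real.sin s / 2)) * (derivative P).eval (q (Real.cos s / 2)))
    (by
      have h1 := (derivative P).continuous
      exact (h1.comp (hpc.comp (by fun_prop))).mul (h1.comp (hqc.comp (by fun_prop))))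
    (fun s => mul_pos (hp.pos _ (hp.mem _ (hs s))) (hq.pos _ (hq.mem _ (hc s))))
    (fun s => by simp)
  set φ : ℝ → ℝ × ℝ := fun t => (p (Real.sin (θ t) / 2), q (Real.cos (θ t) / 2)) with hφ
  have hrange : Set.range φ ⊆ Ioo a b ×ˢ Ioo c d := by
    rintro _ ⟨t, rfl⟩
    exact ⟨hp.mem _ (hs _), hq.mem _ (hc _)⟩
  have hsol : IsSolution (VF P) φ := by
    intro t
    have h1 := HasDerivAt.comp t (hp.hasDerivAt (hs (θ t))) ((hθ t).sin.div_const 2)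
    have h2 := HasDerivAt.comp t (hq.hasDerivAt (hc (θ t))) ((hθ t).cos.div_const 2)
    have hp' := (hp.pos _ (hp.mem _ (hs (θ t)))).ne'
    have hq' := (hq.pos _ (hq.mem _ (hc (θ t)))).ne'
    refine HasDerivAt.congr_deriv (h1.prodMk h2) ?_
    simp only [VF, hφ, hp.right _ (hs (θ t)), hq.right _ (hc (θ t))]
    have hsc := Real.sin_sq_add_cos_sq (θ t)
    refine Prod.ext ?_ ?_
    · field_simp
    · have : (1/4 - (Real.sin (θ t) / 2)^2 - (Real.cos (θ t) / 2)^2) = 0 := by linarith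
      simp only [this]
      field_simp
      ring
  have hper : IsPeriodicOrbit (VF P) φ := by
    refine ⟨hsol, ⟨T, hT, fun t => by simp [hφ, hθT]⟩, ?_⟩
    rintro ⟨v, hv⟩
    obtain ⟨t1, ht1⟩ := hsurj 0
    obtain ⟨t2, ht2⟩ := hsurj π
    have h1 := (hv t1).trans (hv t2).symm
    have h2 : P.eval (φ t1).2 = P.eval (φ t2).2 := by rw [h1]
    simp only [hφ, hq.right _ (hc _), ht1, ht2] at h2
    norm_num at h2
  refine ⟨φ, ⟨hper, Ioo a b ×ˢ Ioo c d, isOpen_Ioo.prod isOpen_Ioo, hrange, ?_⟩, hrange⟩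
  intro ψ hψ hU
  have hl := on_level (p := p) hq hψ hU 0
  have hm := hU ⟨0, rfl⟩
  obtain ⟨α, hα1, hα2⟩ : ∃ α : ℝ, Real.sin α / 2 = P.eval (ψ 0).1 ∧
      Real.cos α / 2 = P.eval (ψ 0).2 := by
    set z : ℂ := ⟨2 * P.eval (ψ 0).2, 2 * P.eval (ψ 0).1⟩ with hz
    have hn : ‖z‖ = 1 := by
      rw [Complex.norm_eq_sqrt_sq_add_sq, Real.sqrt_eq_one]
      simp only [hz]
      linarith
    have hz0 : z ≠ 0 := by
      intro h
      simp [h] at hn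
    refine ⟨Complex.arg z, ?_, ?_⟩
    · rw [Complex.sin_arg, hn]
      simp only [hz]
      ring
    · rw [Complex.cos_arg hz0, hn]
      simp only [hz]
      ring
  obtain ⟨t, rfl⟩ := hsurj α
  refine range_eq_of_meet (VF_contDiff P) hper hψ (s := 0) (t := t) ?_
  have hm' := hrange ⟨t, rfl⟩
  refine Prod.ext ?_ ?_
  · apply hp.strictMonoOn.injOn hm.1 hm'.1
    simp only [hφ, hp.right _ (hs _)]
    exact hα1.symm
  · apply hq.strictMonoOn.injOn hm.2 hm'.2
    simp only [hφ, hq.right _ (hc _)]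
    exact hα2.symm

/-! ### Chebyshev branches -/

lemma cheb_branch (N l : ℕ) (hl : l < N) :
    IsBranch (Chebyshev.T ℝ ((2 * N : ℕ) : ℤ))
      (Real.cos ((2 * π * l + π) / (2 * N))) (Real.cos ((2 * π * l) / (2 * N)))
      (fun u => Real.cos ((2 * π * l + Real.arccos u) / (2 * N))) := by
  have hN : (0:ℝ) < N := by exact_mod_cast (by omega : 0 < N)
  have hl' : (l:ℝ) + 1 ≤ N := by exact_mod_cast hl
  have hpi := Real.pi_pos
  have hl0 : (0:ℝ) ≤ l := Nat.cast_nonneg l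
  have hle : (2 * π * l + π) / (2 * N) ≤ π := by
    rw [div_le_iff₀ (by positivity)]
    nlinarith
  have hge : 0 ≤ (2 * π * l) / (2 * N) := by positivity
  refine ⟨?_, ?_, ?_, ?_⟩
  · have := Real.continuous_arccos
    fun_prop
  · intro u hu
    have h1 : 0 < Real.arccos u := Real.arccos_pos.mpr hu.2
    have h2 : Real.arccos u < π := by
      refine lt_of_le_of_ne (Real.arccos_le_pi u) fun h => ?_
      rw [Real.arccos_eq_pi] at h
      linarith [hu.1]
    have h3 : (2 * π * l) / (2 * N) < (2 * π * l + Real.arccos u) / (2 * N) := by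
      gcongr; linarith
    have h4 : (2 * π * l + Real.arccos u) / (2 * N) < (2 * π * l + π) / (2 * N) := by
      gcongr
    constructor
    · exact Real.cos_lt_cos_of_nonneg_of_le_pi (by linarith) hle h4
    · exact Real.cos_lt_cos_of_nonneg_of_le_pi hge (by linarith) h3
  · intro u hu
    rw [Chebyshev.T_real_cos]
    have : (((2 * N : ℕ) : ℤ) : ℝ) * ((2 * π * l + Real.arccos u) / (2 * N))
        = Real.arccos u + l * (2 * π) := by
      push_cast
      field_simp
      ring
    rw [this, Real.cos_add_nat_mul_two_pi, Real.cos_arccos hu.1.le hu.2.le]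
  · intro x hx
    have hx1 : -1 ≤ x := (Real.neg_one_le_cos _).trans hx.1.le
    have hx2 : x ≤ 1 := hx.2.le.trans (Real.cos_le_one _)
    set s := Real.arccos x with hs
    have hxs : x = Real.cos s := (Real.cos_arccos hx1 hx2).symm
    have hs0 : 0 ≤ s := Real.arccos_nonneg x
    have hspi : s ≤ π := Real.arccos_le_pi x
    have h1 : s < (2 * π * l + π) / (2 * N) := by
      by_contra h
      push Not at h
      have := Real.cos_le_cos_of_nonneg_of_le_pi (hge.trans (by gcongr; linarith)) hspi h
      rw [← hxs] at this
      linarith [hx.1]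
    have h2 : (2 * π * l) / (2 * N) < s := by
      by_contra h
      push Not at h
      have := Real.cos_le_cos_of_nonneg_of_le_pi hs0 (le_trans (by gcongr; linarith) hle) h
      rw [← hxs] at this
      linarith [hx.2]
    have hsin : 0 < Real.sin s := Real.sin_pos_of_pos_of_lt_pi (by linarith) (by linarith)
    rw [lt_div_iff₀ (by positivity)] at h1
    rw [div_lt_iff₀ (by positivity)] at h2
    have hU := Chebyshev.U_real_cos s (((2 * N : ℕ) : ℤ) - 1)
    have hsin2 : 0 < Real.sin (((((2 * N : ℕ) : ℤ) - 1 : ℤ) + 1) * s) := by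
      have : ((((2 * N : ℕ) : ℤ) - 1 : ℤ) + 1) * s = (2 * N * s - l * (2 * π)) + l * (2 * π) := by
        push_cast
        ring
      rw [this, Real.sin_add_nat_mul_two_pi]
      apply Real.sin_pos_of_pos_of_lt_pi <;> linarith
    rw [← hU, ← hxs] at hsin2
    have hUpos := pos_of_mul_pos_left hsin2 hsin.le
    rw [Chebyshev.T_derivative_eq_U, eval_mul]
    refine mul_pos ?_ hUpos
    simp
    omega

lemma cheb_disjoint {N l l' : ℕ} (hl : l < N) (hl' : l' < N) {x : ℝ}
    (hx : x ∈ Ioo (Real.cos ((2 * π * l + π) / (2 * N))) (Real.cos ((2 * π * l) / (2 * N))))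
    (hx' : x ∈ Ioo (Real.cos ((2 * π * l' + π) / (2 * N))) (Real.cos ((2 * π * l') / (2 * N)))) :
    l = l' := by
  have aux : ∀ {l l' : ℕ}, l < N → l' < N → l < l' →
      Real.cos ((2 * π * l') / (2 * N)) ≤ Real.cos ((2 * π * l + π) / (2 * N)) := by
    intro l l' hl hl' hlt
    have hN : (0:ℝ) < N := by exact_mod_cast (by omega : 0 < N)
    have h1 : (l:ℝ) + 1 ≤ l' := by exact_mod_cast hlt
    have h2 : (l':ℝ) + 1 ≤ N := by exact_mod_cast hl'
    have hpi := Real.pi_pos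
    apply Real.cos_le_cos_of_nonneg_of_le_pi (by positivity)
    · rw [div_le_iff₀ (by positivity)]
      nlinarith
    · gcongr
      nlinarith
  rcases lt_trichotomy l l' with h | h | h
  · have := aux hl hl' h
    linarith [hx.1, hx'.2]
  · exact h
  · have := aux hl' hl h
    linarith [hx'.1, hx.2]

lemma many_cycles (N L : ℕ) (hL : L ≤ N * N) :
    HasAtLeastNLimitCycles (VF (Chebyshev.T ℝ ((2 * N : ℕ) : ℤ))) L := by
  have hex := fun ij : Fin N × Fin N =>
    exists_cycle (cheb_branch N ij.1 ij.1.2) (cheb_branch N ij.2 ij.2.2)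
  choose φ hφ hr using hex
  obtain ⟨e⟩ : Nonempty (Fin L ↪ Fin N × Fin N) := by
    apply Function.Embedding.nonempty_of_card_le
    simpa using hL
  refine ⟨fun i => φ (e i), fun i => hφ _, ?_⟩
  intro i j hij heq
  apply hij
  apply e.injective
  have h1 := hr (e i) ⟨0, rfl⟩
  have h2 : φ (e i) 0 ∈ Set.range (φ (e j)) := by
    rw [← heq]
    exact ⟨0, rfl⟩
  have h3 := hr (e j) h2
  refine Prod.ext (Fin.ext ?_) (Fin.ext ?_)
  · exact cheb_disjoint (e i).1.2 (e j).1.2 h1.1 h3.1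
  · exact cheb_disjoint (e i).2.2 (e j).2.2 h1.2 h3.2

/-! ### Counting monomials -/

/-- Sum of `m` real multiples of monomial vector fields. -/
def MonoRep (m : ℕ) (f : ℝ × ℝ → ℝ × ℝ) : Prop :=
  ∃ (X : Fin m → ℝ × ℝ → ℝ × ℝ) (a : Fin m → ℝ),
    (∀ j, IsMonomialVF (X j)) ∧ (fun p : ℝ × ℝ => ∑ j, a j • X j p) = f

lemma MonoRep.add {m m' : ℕ} {f f' : ℝ × ℝ → ℝ × ℝ} (h : MonoRep m f) (h' : MonoRep m' f') :
    MonoRep (m + m') (fun p => f p + f' p) := by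
  obtain ⟨X, a, hX, rfl⟩ := h
  obtain ⟨X', a', hX', rfl⟩ := h'
  refine ⟨Fin.append X X', Fin.append a a', ?_, ?_⟩
  · intro j
    refine Fin.addCases (fun i => ?_) (fun i => ?_) j
    · simpa using hX i
    · simpa using hX' i
  · funext p
    simp [Fin.sum_univ_add]

lemma MonoRep.zero (m : ℕ) : MonoRep m (fun _ => 0) :=
  ⟨fun _ p => (p.1 ^ 0 * p.2 ^ 0, 0), fun _ => 0, fun _ => ⟨0, 0, Or.inl rfl⟩, by simp⟩

lemma eval_sum_fin {Q : ℝ[X]} {m : ℕ} (h : Q.natDegree < m) (x : ℝ) :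
    Q.eval x = ∑ j : Fin m, Q.coeff j * x ^ (j : ℕ) := by
  rw [eval_eq_sum_range' h, Finset.sum_range]

lemma rep_fst_y {Q : ℝ[X]} {m : ℕ} (h : Q.natDegree < m) :
    MonoRep m (fun p => (Q.eval p.2, 0)) := by
  refine ⟨fun j p => (p.1 ^ 0 * p.2 ^ (j:ℕ), 0), fun j => Q.coeff j,
    fun j => ⟨0, j, Or.inl rfl⟩, ?_⟩
  funext p
  refine Prod.ext ?_ ?_
  · simp [Prod.fst_sum, eval_sum_fin h]
  · simp [Prod.snd_sum]

lemma rep_snd_x (k : ℕ) {Q : ℝ[X]} {m : ℕ} (h : Q.natDegree < m) :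
    MonoRep m (fun p => (0, Q.eval p.1 * p.2 ^ k)) := by
  refine ⟨fun j p => (0, p.1 ^ (j:ℕ) * p.2 ^ k), fun j => Q.coeff j,
    fun j => ⟨j, k, Or.inr rfl⟩, ?_⟩
  funext p
  refine Prod.ext ?_ ?_
  · simp [Prod.fst_sum]
  · simp [Prod.snd_sum, eval_sum_fin h, Finset.sum_mul, mul_assoc]

lemma rep_snd_y {Q : ℝ[X]} {m : ℕ} (h : Q.natDegree < m) :
    MonoRep m (fun p => (0, Q.eval p.2)) := by
  refine ⟨fun j p => (0, p.1 ^ 0 * p.2 ^ (j:ℕ)), fun j => Q.coeff j,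
    fun j => ⟨0, j, Or.inr rfl⟩, ?_⟩
  funext p
  refine Prod.ext ?_ ?_
  · simp [Prod.fst_sum]
  · simp [Prod.snd_sum, eval_sum_fin h]

lemma rep_VF {P : ℝ[X]} {D : ℕ} (h : 2 * P.natDegree + 1 < D) :
    MonoRep (D + D + D + D + 3) (VF P) := by
  have hd : (derivative P).natDegree ≤ P.natDegree :=
    (natDegree_derivative_le P).trans (Nat.sub_le _ _)
  have hA : (P * derivative P).natDegree < D :=
    lt_of_le_of_lt natDegree_mul_le (by omega)
  have hB : (-(P * derivative P)).natDegree < D := by rwa [natDegree_neg]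
  have hP2 : (P ^ 2).natDegree ≤ 2 * P.natDegree := natDegree_pow_le
  have hC : (C (1/4) - P ^ 2).natDegree < D := by
    refine lt_of_le_of_lt (natDegree_sub_le _ _) ?_
    rw [natDegree_C]
    omega
  have hE : (-(X * P ^ 2)).natDegree < D := by
    rw [natDegree_neg]
    refine lt_of_le_of_lt natDegree_mul_le ?_
    rw [natDegree_X]
    omega
  have := ((((rep_fst_y hA).add (rep_snd_x 0 hB)).add (rep_snd_x 1 hC)).add
    (rep_snd_y hE)).add (MonoRep.zero 3)
  convert this using 1
  funext p
  refine Prod.ext ?_ ?_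
  · simp [VF]
  · simp [VF]
    ring

lemma pow_bound (k : ℕ) : 2 ^ (k + 12) * (k + 12) ≤ 2 ^ (k + 8) * 2 ^ (k + 8) := by
  have h : k + 12 ≤ 2 ^ (k + 4) := by
    induction k with
    | zero => norm_num
    | succ n ih => rw [show n + 1 + 4 = (n + 4) + 1 by ring, pow_succ]; omega
  calc 2 ^ (k + 12) * (k + 12) ≤ 2 ^ (k + 12) * 2 ^ (k + 4) := by gcongr
    _ = 2 ^ (k + 8) * 2 ^ (k + 8) := by ring

end

/-- There are a sequence of integers `m_k → ∞` and, for each `k`, a planar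
polynomial system whose right-hand side consists of `m_k` monomial vector fields having at
least `L_k` limit cycles, where
`liminf_{k→∞} (L_k · 2 log 2) / ((m_k - 3) · log ((m_k - 3)/2)) ≥ 1`. -/
theorem statement4 :
    ∃ (m : ℕ → ℕ) (L : ℕ → ℕ),
      Tendsto m atTop atTop ∧
      (∀ k, ∃ (X : Fin (m k) → ℝ × ℝ → ℝ × ℝ) (a : Fin (m k) → ℝ),
        (∀ j, IsMonomialVF (X j)) ∧
        HasAtLeastNLimitCycles (fun p : ℝ × ℝ => ∑ j, a j • X j p) (L k)) ∧
      1 ≤ liminf (fun k : ℕ =>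
        ((L k : ℝ) * (2 * Real.log 2)) /
          (((m k : ℝ) - 3) * Real.log (((m k : ℝ) - 3) / 2))) atTop := by
  refine ⟨fun k => 8 * 2 ^ (k + 8) + 8 * 2 ^ (k + 8) + 8 * 2 ^ (k + 8) + 8 * 2 ^ (k + 8) + 3,
    fun k => 2 ^ (k + 12) * (k + 12), ?_, ?_, ?_⟩
  · refine tendsto_atTop_mono (fun k => ?_) tendsto_id
    have : k + 8 < 2 ^ (k + 8) := Nat.lt_two_pow_self
    simp only [id]
    omega
  · intro k
    have hpos : 0 < 2 ^ (k + 8) := by positivity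
    have hrep : MonoRep (8 * 2 ^ (k + 8) + 8 * 2 ^ (k + 8) + 8 * 2 ^ (k + 8) + 8 * 2 ^ (k + 8) + 3)
        (VF (Polynomial.Chebyshev.T ℝ ((2 * 2 ^ (k + 8) : ℕ) : ℤ))) := by
      apply rep_VF
      rw [Polynomial.Chebyshev.natDegree_T, Int.natAbs_natCast]
      omega
    obtain ⟨X, a, hX, he⟩ := hrep
    refine ⟨X, a, hX, ?_⟩
    rw [he]
    exact many_cycles _ _ (pow_bound k)
  · have hone : ∀ k : ℕ, (((2 ^ (k + 12) * (k + 12) : ℕ) : ℝ) * (2 * Real.log 2)) /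
          ((((8 * 2 ^ (k + 8) + 8 * 2 ^ (k + 8) + 8 * 2 ^ (k + 8) + 8 * 2 ^ (k + 8) + 3 : ℕ) : ℝ) - 3)
          * Real.log ((((8 * 2 ^ (k + 8) + 8 * 2 ^ (k + 8) + 8 * 2 ^ (k + 8) + 8 * 2 ^ (k + 8) + 3
            : ℕ) : ℝ) - 3) / 2)) = 1 := by
      intro k
      have h1 : (((8 * 2 ^ (k + 8) + 8 * 2 ^ (k + 8) + 8 * 2 ^ (k + 8) + 8 * 2 ^ (k + 8) + 3
            : ℕ) : ℝ) - 3) = 2 ^ (k + 12) * 2 := by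
        push_cast
        ring
      have hlog : 0 < Real.log 2 := Real.log_pos (by norm_num)
      rw [h1, mul_div_cancel_right₀ _ (two_ne_zero), Real.log_pow]
      push_cast
      rw [div_eq_one_iff_eq (by positivity)]
      ring
    simp only [hone]
    simp
end
end
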